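/- Let f : ℚ → ℚ be given by f(x) = 3⁷(x²−1)³(x⁶+3x⁵+6x⁴+x³−3x²+12x+16)³(2x³+3x²−3x−5)/(x³−3x−1)⁹. The set of nonzero integers k such that f(x) = k for some rational x is exactly {419904, −44789760, 15786448344, 24992518538304, −92515041526500, −70043919611288518656}, attained respectively at x = −2, 0, −1/2, 2, −3/2, −1/3 (the value 0 being attained at x = ±1, and the remaining integral value 4374 of the paper's table being attained only at the point x = ∞ of ℙ¹(ℚ)). -/

import Mathlib

/-- The degree-27 rational function f realizing the covering map 𝒳₉ → X(1). -/
def f (x : ℚ) : ℚ :=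
  3 ^ 7 * (x ^ 2 - 1) ^ 3 *
      (x ^ 6 + 3 * x ^ 5 + 6 * x ^ 4 + x ^ 3 - 3 * x ^ 2 + 12 * x + 16) ^ 3 *
      (2 * x ^ 3 + 3 * x ^ 2 - 3 * x - 5) / (x ^ 3 - 3 * x - 1) ^ 9

section

open Finset Polynomial

/-- The numerator `∏ (3j - 1) ∏ (3j + 1)` of the `k`-th coefficient of the degree `n` Padé
approximant of the cube root. -/
def padeNum (n k : ℕ) : ℕ := (∏ j ∈ Ioc k n, (3 * j - 1)) * ∏ j ∈ Ioc (n - k) n, (3 * j + 1)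

lemma card_filter_dvd_add (d c n : ℕ) :
    #{j ∈ Ioc 0 n | d ∣ j + c} = (n + c) / d - c / d := by
  induction n with
  | zero => simp
  | succ n ih =>
    rw [← Finset.insert_Ioc_right_eq_Ioc_add_one (Nat.zero_le n), Finset.filter_insert]
    have h1 : (n + c + 1) / d = _ := Nat.succ_div
    have h2 : c / d ≤ (n + c) / d := Nat.div_le_div_right (by omega)
    have h3 : n + 1 + c = n + c + 1 := by omega
    rw [h3, h1]
    split_ifs with h
    · rw [card_insert_of_notMem (by simp), ih]; omega
    · rw [ih]; omega

lemma card_filter_dvd_add_Ioc (d c k n : ℕ) (hk : k ≤ n) :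
    #{j ∈ Ioc k n | d ∣ j + c} + (k + c) / d = (n + c) / d := by
  have h := card_filter_dvd_add d c n
  have h' := card_filter_dvd_add d c k
  have e : Ioc 0 n = Ioc 0 k ∪ Ioc k n := (Ioc_union_Ioc_eq_Ioc (by omega) hk).symm
  rw [e, filter_union, card_union_of_disjoint] at h
  · have h2 : c / d ≤ (n + c) / d := Nat.div_le_div_right (by omega)
    have h3 : c / d ≤ (k + c) / d := Nat.div_le_div_right (by omega)
    omega
  · apply disjoint_filter_filter
    rw [Finset.disjoint_left]; intro a; simp; omega

/-- Legendre's formula for a product. -/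
lemma factorization_prod_eq_sum {p b : ℕ} (hp : p.Prime) (s : Finset ℕ) (g : ℕ → ℕ)
    (h0 : ∀ j ∈ s, 0 < g j) (hb : ∀ j ∈ s, g j < p ^ b) :
    (∏ j ∈ s, g j).factorization p = ∑ i ∈ Ico 1 b, #{j ∈ s | p ^ i ∣ g j} := by
  rw [Nat.factorization_prod (fun j hj => (h0 j hj).ne'), Finsupp.finsetSum_apply]
  simp_rw [card_filter]
  rw [sum_comm]
  refine sum_congr rfl fun j hj => ?_
  rw [Nat.factorization_eq_card_pow_dvd_of_lt hp (h0 j hj) (hb j hj), card_filter]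

lemma factorization_factorial_eq_sum {p b n : ℕ} (hp : p.Prime) (hb : n < p ^ b) :
    (n.factorial).factorization p = ∑ i ∈ Ico 1 b, n / p ^ i := by
  rw [← Finset.prod_Ico_id_eq_factorial]
  rw [factorization_prod_eq_sum (b := b) hp _ _ (by simp; omega) (by simp; omega)]
  refine sum_congr rfl fun i _ => ?_
  have h := card_filter_dvd_add_Ioc (p ^ i) 0 0 n (Nat.zero_le _)
  simp at h
  rw [← h]
  congr 1

lemma count_dvd_sub_one {d c k n : ℕ} (hd : d.Coprime 3) (hc : d ∣ 3 * c + 1) (hk : k ≤ n) :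
    #{j ∈ Ioc k n | d ∣ 3 * j - 1} + (k + c) / d = (n + c) / d := by
  rw [← card_filter_dvd_add_Ioc d c k n hk]
  congr 2
  refine filter_congr fun j hj => ?_
  have hj : 1 ≤ j := by simp at hj; omega
  have e : 3 * (j + c) = (3 * j - 1) + (3 * c + 1) := by omega
  rw [← (Nat.Coprime.dvd_mul_left hd : d ∣ 3 * (j + c) ↔ d ∣ j + c), e, Nat.dvd_add_left hc]

lemma count_dvd_add_one {d c k n : ℕ} (hd : d.Coprime 3) (hc : d ∣ 3 * c - 1) (h1 : 1 ≤ c)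
    (hk : k ≤ n) :
    #{j ∈ Ioc k n | d ∣ 3 * j + 1} + (k + c) / d = (n + c) / d := by
  rw [← card_filter_dvd_add_Ioc d c k n hk]
  congr 2
  refine filter_congr fun j hj => ?_
  have e : 3 * (j + c) = (3 * j + 1) + (3 * c - 1) := by omega
  rw [← (Nat.Coprime.dvd_mul_left hd : d ∣ 3 * (j + c) ↔ d ∣ j + c), e, Nat.dvd_add_left hc]

lemma div_eq_add_of_mod (d q x : ℕ) (hd : 0 < d) : (d * q + x) / d = q + x / d := by
  rw [Nat.mul_add_div hd]

lemma div_lt_three_cases (d x : ℕ) (hd : 0 < d) (h : x < 3 * d) :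
    (x / d = 0 ∧ x < d) ∨ (x / d = 1 ∧ d ≤ x ∧ x < 2 * d) ∨ (x / d = 2 ∧ 2 * d ≤ x) := by
  have h1 := Nat.div_add_mod x d
  have h2 := Nat.mod_lt x hd
  have h3 : x / d < 3 := Nat.div_lt_of_lt_mul (by linarith)
  generalize x / d = q at *
  interval_cases q <;> omega

/-- The count at a prime power `d` in the numerators of the Padé coefficients. -/
lemma count_ge {d : ℕ} (hd : d.Coprime 3) (h2 : 2 ≤ d) {n k : ℕ} (hk : k ≤ n) :
    k / d + (n - k) / d + (if 2 * d ≤ 3 * (n % d) then 1 else 0) ≤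
      #{j ∈ Ioc k n | d ∣ 3 * j - 1} + #{j ∈ Ioc (n - k) n | d ∣ 3 * j + 1} := by
  have hd0 : 0 < d := by omega
  obtain ⟨c, hcd, h0, hc⟩ : ∃ c, c < d ∧ 0 < c ∧ (3 * c + 1 = d ∨ 3 * c + 1 = 2 * d) := by
    have h3 : d % 3 ≠ 0 := by
      intro h
      have := Nat.dvd_gcd (Nat.dvd_of_mod_eq_zero h) (dvd_refl 3)
      rw [hd] at this; omega
    rcases (by omega : d % 3 = 1 ∨ d % 3 = 2) with h | h
    · exact ⟨d / 3, by omega, by omega, by omega⟩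
    · exact ⟨(2 * d) / 3, by omega, by omega, by omega⟩
  have hA := count_dvd_sub_one (c := c) hd
    (by rcases hc with h | h <;> rw [h]; exact Dvd.intro_left 2 rfl) hk
  have hB := count_dvd_add_one (c := d - c) (k := n - k) (n := n) hd (by
    rcases hc with h | h
    · rw [show 3 * (d - c) - 1 = d * 2 by omega]; exact dvd_mul_right _ _
    · rw [show 3 * (d - c) - 1 = d * 1 by omega]; exact dvd_mul_right _ _) (by omega) (by omega)
  obtain ⟨l, rfl⟩ := Nat.exists_eq_add_of_le hk
  rw [Nat.add_sub_cancel_left] at hB ⊢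
  have ek := Nat.div_add_mod k d
  have el := Nat.div_add_mod l d
  have lk := Nat.mod_lt k hd0
  have ll := Nat.mod_lt l hd0
  generalize k / d = k1 at *
  generalize k % d = κ at *
  generalize l / d = l1 at *
  generalize l % d = μ at *
  subst ek el
  have e1 : d * k1 + κ + (d * l1 + μ) = d * (k1 + l1) + (κ + μ) := by ring
  rw [e1, add_assoc, add_assoc, div_eq_add_of_mod _ _ _ hd0, div_eq_add_of_mod _ _ _ hd0] at hA
  rw [e1, add_assoc, add_assoc, div_eq_add_of_mod _ _ _ hd0, div_eq_add_of_mod _ _ _ hd0] at hB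
  rw [e1, Nat.mul_add_mod]
  have s1 := div_lt_three_cases d (κ + c) hd0 (by omega)
  have s2 := div_lt_three_cases d (κ + μ + c) hd0 (by omega)
  have s3 := div_lt_three_cases d (μ + (d - c)) hd0 (by omega)
  have s4 := div_lt_three_cases d (κ + μ + (d - c)) hd0 (by omega)
  have s5 := div_lt_three_cases d (κ + μ) hd0 (by omega)
  have hm : (κ + μ) % d = κ + μ - d * ((κ + μ) / d) := by
    have := Nat.div_add_mod (κ + μ) d; omega
  rw [e1] at *
  generalize #{j ∈ Ioc (d * k1 + κ) (d * (k1 + l1) + (κ + μ)) | d ∣ 3 * j - 1} = N1 at *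
  generalize #{j ∈ Ioc (d * l1 + μ) (d * (k1 + l1) + (κ + μ)) | d ∣ 3 * j + 1} = N2 at *
  generalize (κ + c) / d = q1 at *
  generalize (κ + μ + c) / d = q2 at *
  generalize (μ + (d - c)) / d = q3 at *
  generalize (κ + μ + (d - c)) / d = q4 at *
  have hm' : (κ + μ) % d = κ + μ ∧ κ + μ < d ∨ (κ + μ) % d + d = κ + μ := by
    rcases s5 with ⟨h, h'⟩ | ⟨h, h'⟩ | ⟨h, h'⟩
    · rw [h] at hm; omega
    · rw [h] at hm; omega
    · omega
  clear hm s5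
  generalize (κ + μ) % d = ν at *
  split_ifs <;> omega

lemma twelve_div (N d : ℕ) : 6 * N / d = (12 * N / d) / 2 ∧ N / d = (12 * N / d) / 12 ∧
    4 * N / d = (12 * N / d) / 3 ∧ 3 * N / d = (12 * N / d) / 4 := by
  refine ⟨?_, ?_, ?_, ?_⟩ <;> rw [Nat.div_div_eq_div_mul, mul_comm d, ← Nat.div_div_eq_div_mul] <;>
    congr 1 <;> omega

lemma ratio_le_one (N d : ℕ) : 6 * N / d + N / d ≤ 4 * N / d + 3 * N / d + 1 := by
  obtain ⟨h1, h2, h3, h4⟩ := twelve_div N d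
  rw [h1, h2, h3, h4]; omega

lemma ratio_le_indicator (N d : ℕ) (hd : 0 < d) :
    6 * N / d + N / d ≤ 4 * N / d + 3 * N / d + if 2 * d ≤ 3 * (4 * N % d) then 1 else 0 := by
  obtain ⟨h1, h2, h3, h4⟩ := twelve_div N d
  have e := Nat.div_add_mod (4 * N) d
  have e' : 12 * N = d * (3 * (4 * N / d)) + 3 * (4 * N % d) := by linarith
  have l := Nat.mod_lt (4 * N) hd
  have s := div_lt_three_cases d (3 * (4 * N % d)) hd (by omega)
  have e2 : 12 * N / d = 3 * (4 * N / d) + 3 * (4 * N % d) / d := by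
    conv_lhs => rw [e', div_eq_add_of_mod _ _ _ hd]
  rw [h1, h2, h3, h4]
  generalize 12 * N / d = m at *
  clear e e'
  generalize 3 * (4 * N % d) / d = q at *
  generalize 4 * N / d = q' at *
  obtain ⟨t, j, hj, rfl⟩ : ∃ t j, j < 4 ∧ q' = 4 * t + j := ⟨q' / 4, q' % 4, by omega, by omega⟩
  rw [← h3]
  rcases s with ⟨rfl, s⟩ | ⟨rfl, s⟩ | ⟨rfl, s⟩ <;> interval_cases j <;> split_ifs <;> omega

lemma ratio_indicator_le (N d n : ℕ) (hd : 0 < d) (hn : n = 4 * N ∨ n = 4 * N + 1) :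
    (if 2 * d ≤ 3 * (4 * N % d) then 1 else 0) ≤
      (if 2 * d ≤ 3 * (n % d) then 1 else 0) + if d ∣ 4 * N + 1 then 1 else 0 := by
  rcases hn with rfl | rfl
  · omega
  · by_cases h : d ∣ 4 * N + 1
    · simp only [h, if_true]; split_ifs <;> omega
    · have l := Nat.mod_lt (4 * N) hd
      have e := Nat.div_add_mod (4 * N) d
      have hne : 4 * N % d + 1 ≠ d := by
        intro h'
        apply h
        refine ⟨4 * N / d + 1, ?_⟩
        rw [mul_add, mul_one]; omega
      have : (4 * N + 1) % d = 4 * N % d + 1 := by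
        conv_lhs => rw [← e, add_assoc, Nat.mul_add_mod]
        exact Nat.mod_eq_of_lt (by omega)
      rw [this]; split_ifs <;> omega

lemma padeNum_ne_zero (n k : ℕ) : padeNum n k ≠ 0 := by
  unfold padeNum
  refine mul_ne_zero ?_ ?_ <;> rw [prod_ne_zero_iff] <;> intro j hj <;> simp at hj <;> omega

lemma factorization_le_of_ne_three {p N n k : ℕ} (hp : p.Prime) (hp3 : p ≠ 3)
    (hn : n = 4 * N ∨ n = 4 * N + 1) (hk : k ≤ n) :
    ((6 * N).factorial * N.factorial * (k.factorial * (n - k).factorial)).factorization p ≤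
    ((4 * N + 1) * padeNum n k * ((4 * N).factorial * (3 * N).factorial)).factorization p := by
  obtain ⟨b, hb⟩ : ∃ b, 12 * N + 12 < p ^ b := ⟨_, Nat.lt_pow_self hp.one_lt⟩
  have f0 := Nat.factorial_ne_zero
  rw [Nat.factorization_mul (mul_ne_zero (f0 _) (f0 _)) (mul_ne_zero (f0 _) (f0 _)),
    Nat.factorization_mul (f0 _) (f0 _), Nat.factorization_mul (f0 _) (f0 _),
    Nat.factorization_mul (mul_ne_zero (by omega) (padeNum_ne_zero _ _))
      (mul_ne_zero (f0 _) (f0 _)),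
    Nat.factorization_mul (by omega) (padeNum_ne_zero _ _),
    Nat.factorization_mul (f0 _) (f0 _), padeNum, Nat.factorization_mul
      (left_ne_zero_of_mul (padeNum_ne_zero n k)) (right_ne_zero_of_mul (padeNum_ne_zero n k))]
  simp only [Finsupp.add_apply]
  rw [factorization_factorial_eq_sum (b := b) hp (by omega),
    factorization_factorial_eq_sum (b := b) hp (by omega),
    factorization_factorial_eq_sum (b := b) hp (by omega),
    factorization_factorial_eq_sum (b := b) hp (by omega),
    factorization_factorial_eq_sum (b := b) hp (by omega),
    factorization_factorial_eq_sum (b := b) hp (by omega),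
    factorization_prod_eq_sum (b := b) hp _ _ (by simp; omega) (by simp; omega),
    factorization_prod_eq_sum (b := b) hp _ _ (by simp) (by simp; omega),
    Nat.factorization_eq_card_pow_dvd_of_lt hp (by omega) (by omega : 4 * N + 1 < p ^ b),
    card_filter]
  simp only [← sum_add_distrib]
  refine sum_le_sum fun i hi => ?_
  have hi : i ≠ 0 := by simp at hi; omega
  have hco : (p ^ i).Coprime 3 :=
    Nat.Coprime.pow_left _ ((Nat.coprime_primes hp Nat.prime_three).2 hp3)
  have h2 : 2 ≤ p ^ i := hp.two_le.trans (Nat.le_self_pow hi p)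
  have a1 := count_ge hco h2 hk
  have a2 := ratio_le_indicator N (p ^ i) (by omega)
  have a3 := ratio_indicator_le N (p ^ i) n (by omega) hn
  omega

lemma exists_pow_three_mul_dvd {a b : ℕ} (ha : a ≠ 0) (hb : b ≠ 0)
    (h : ∀ p, p.Prime → p ≠ 3 → a.factorization p ≤ b.factorization p) :
    ∃ M, a ∣ 3 ^ M * b := by
  refine ⟨a.factorization 3, ?_⟩
  rw [← Nat.factorization_le_iff_dvd ha (by positivity)]
  intro p
  rw [Nat.factorization_mul (by positivity) hb, Finsupp.add_apply]
  by_cases hp : p.Prime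
  · by_cases h3 : p = 3
    · subst h3
      rw [Nat.Prime.factorization_pow Nat.prime_three]; simp
    · exact (h p hp h3).trans (Nat.le_add_left _ _)
  · rw [Nat.factorization_eq_zero_of_not_prime _ hp]; omega

/-- Up to powers of `3` and the factor `4N+1`, the coefficients of the Padé approximants of degree
`4N` and `4N+1` are divisible by `(6N)! N! / ((4N)! (3N)!)`. -/
lemma content_dvd {N n k : ℕ} (hn : n = 4 * N ∨ n = 4 * N + 1) (hk : k ≤ n) :
    ∃ M, (6 * N).factorial * N.factorial * (k.factorial * (n - k).factorial) ∣
      3 ^ M * ((4 * N + 1) * padeNum n k * ((4 * N).factorial * (3 * N).factorial)) := by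
  have f0 := Nat.factorial_ne_zero
  refine exists_pow_three_mul_dvd
    (mul_ne_zero (mul_ne_zero (f0 _) (f0 _)) (mul_ne_zero (f0 _) (f0 _)))
    (mul_ne_zero (mul_ne_zero (by omega) (padeNum_ne_zero _ _)) (mul_ne_zero (f0 _) (f0 _))) ?_
  intro p hp hp3
  exact factorization_le_of_ne_three hp hp3 hn hk

lemma exists_coprime_three_mul_dvd {a b : ℕ} (ha : a ≠ 0) (hb : b ≠ 0)
    (h : a.factorization 3 ≤ b.factorization 3) : ∃ L, L.Coprime 3 ∧ a ∣ L * b := by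
  refine ⟨a / 3 ^ a.factorization 3, (Nat.coprime_ordCompl Nat.prime_three ha).symm, ?_⟩
  have h1 := Nat.ordProj_mul_ordCompl_eq_self a 3
  have h2 : 3 ^ a.factorization 3 ∣ b :=
    (Nat.Prime.pow_dvd_iff_le_factorization Nat.prime_three hb).2 h
  conv_lhs => rw [← h1, mul_comm]
  exact Nat.mul_dvd_mul_left _ h2

/-- The `3`-part of `(6N)! N! / ((4N)! (3N)!)` is at most `6N`. -/
lemma ratio_three_part (N : ℕ) (hN : 0 < N) : ∃ r L, 3 ^ r ≤ 6 * N ∧ L.Coprime 3 ∧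
    (6 * N).factorial * N.factorial ∣ L * (3 ^ r * ((4 * N).factorial * (3 * N).factorial)) := by
  have f0 := Nat.factorial_ne_zero
  suffices h : ((6 * N).factorial * N.factorial).factorization 3 ≤
      (3 ^ (Nat.log 3 (6 * N)) * ((4 * N).factorial * (3 * N).factorial)).factorization 3 by
    obtain ⟨L, h1, h2⟩ := exists_coprime_three_mul_dvd (mul_ne_zero (f0 _) (f0 _))
      (mul_ne_zero (by positivity) (mul_ne_zero (f0 _) (f0 _))) h
    exact ⟨_, L, Nat.pow_log_le_self 3 (by omega), h1, h2⟩
  have hb : 6 * N < 3 ^ (Nat.log 3 (6 * N) + 1) := Nat.lt_pow_succ_log_self (by norm_num) _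
  have p3 := Nat.prime_three
  rw [Nat.factorization_mul (f0 _) (f0 _), Nat.factorization_mul (by positivity)
    (mul_ne_zero (f0 _) (f0 _)), Nat.factorization_mul (f0 _) (f0 _)]
  simp only [Finsupp.add_apply]
  rw [p3.factorization_pow, Finsupp.single_eq_same,
    factorization_factorial_eq_sum p3 hb,
    factorization_factorial_eq_sum (b := Nat.log 3 (6 * N) + 1) p3 (by omega : N < _),
    factorization_factorial_eq_sum (b := Nat.log 3 (6 * N) + 1) p3 (by omega : 4 * N < _),
    factorization_factorial_eq_sum (b := Nat.log 3 (6 * N) + 1) p3 (by omega : 3 * N < _)]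
  have e : Nat.log 3 (6 * N) = ∑ i ∈ Ico 1 (Nat.log 3 (6 * N) + 1), 1 := by simp
  conv_rhs => rw [e, ← e]
  conv_rhs => enter [1]; rw [e]
  simp only [← sum_add_distrib]
  refine sum_le_sum fun i _ => ?_
  have := ratio_le_one N (3 ^ i)
  omega

/-- The `k`-th coefficient of the numerator of the degree `n` Padé approximant of the cube root. -/
noncomputable def padeCoeff (n k : ℕ) : ℂ := padeNum n k / (k.factorial * (n - k).factorial)

lemma prod_Ioc_mul_prod_range (g : ℕ → ℂ) {k n : ℕ} (h : k ≤ n) :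
    (∏ j ∈ Ioc k n, g j) * ∏ i ∈ range k, g (i + 1) = ∏ i ∈ range n, g (i + 1) := by
  induction n, h using Nat.le_induction with
  | base => simp
  | succ n h ih =>
    rw [prod_range_succ, ← ih, ← Finset.insert_Ioc_right_eq_Ioc_add_one h,
      prod_insert (by simp)]
    ring

lemma padeNum_mul (n k : ℕ) (h : k ≤ n) :
    (padeNum n k : ℂ) * ((∏ i ∈ range k, (3 * (i + 1) - 1 : ℂ)) *
      ∏ i ∈ range (n - k), (3 * (i + 1) + 1 : ℂ)) =
    (∏ i ∈ range n, (3 * (i + 1) - 1 : ℂ)) * ∏ i ∈ range n, (3 * (i + 1) + 1 : ℂ) := by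
  have h1 := prod_Ioc_mul_prod_range (fun j => (3 * j - 1 : ℂ)) h
  have h2 := prod_Ioc_mul_prod_range (fun j => (3 * j + 1 : ℂ)) (Nat.sub_le n k)
  push_cast at h1 h2
  rw [← h1, ← h2, padeNum]
  push_cast
  have e : ∏ x ∈ Ioc k n, (((3 * x - 1 : ℕ) : ℂ)) = ∏ x ∈ Ioc k n, (3 * x - 1 : ℂ) := by
    refine prod_congr rfl fun j hj => ?_
    rw [Nat.cast_sub (by simp at hj; omega)]; push_cast; ring
  rw [e]; ring

lemma prod_range_split (g : ℕ → ℂ) (k l : ℕ) :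
    ∏ j ∈ range (k + l + 1), g j =
      (∏ i ∈ range k, g (k - 1 - i)) * g k * ∏ i ∈ range l, g (k + (i + 1)) := by
  rw [add_assoc, prod_range_add, prod_range_succ' _ l, prod_range_reflect g k]
  simp only [add_zero]; ring

lemma prod_erase_range (g : ℕ → ℂ) (k l : ℕ) :
    ∏ j ∈ (range (k + l + 1)).erase k, g j =
      (∏ i ∈ range k, g (k - 1 - i)) * ∏ i ∈ range l, g (k + (i + 1)) := by
  have h := prod_range_split (fun j => if j = k then 1 else g j) k l
  rw [← prod_erase (range (k + l + 1)) (by simp : (fun j => if j = k then 1 else g j) k = 1)] at h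
  rw [prod_congr rfl (g := fun j => if j = k then 1 else g j)
    (fun j hj => by simp [Finset.ne_of_mem_erase hj]), h]
  simp only [if_true, mul_one]
  congr 1
  · refine prod_congr rfl fun i hi => ?_
    rw [if_neg (by simp at hi; omega)]
  · refine prod_congr rfl fun i hi => ?_
    rw [if_neg (by omega)]

lemma prod_const_mul_succ (c : ℂ) (k : ℕ) :
    ∏ i ∈ range k, (c * (i + 1)) = c ^ k * k.factorial := by
  rw [prod_mul_distrib, prod_const, card_range, ← prod_range_add_one_eq_factorial]; push_cast; rfl

lemma prod_neg_range (g : ℕ → ℂ) (k : ℕ) :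
    ∏ i ∈ range k, -g i = (-1) ^ k * ∏ i ∈ range k, g i := by
  rw [prod_neg, card_range]

/-- The exponents `3k` and `3k+1`. -/
def padeNode : ℕ ⊕ ℕ → ℕ := Sum.elim (fun k => 3 * k) (fun k => 3 * k + 1)

/-- The coefficients of the degree `3n+1` polynomial `α(s³) - s β(s³)`. -/
noncomputable def padeWeight (n : ℕ) : ℕ ⊕ ℕ → ℂ :=
  Sum.elim (fun k => padeCoeff n k) (fun k => -padeCoeff n (n - k))

/-- The index set of the exponents of the degree `3n+1` polynomial `α(s³) - s β(s³)`. -/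
def padeIndex (n : ℕ) : Finset (ℕ ⊕ ℕ) := (range (n + 1)).disjSum (range (n + 1))

lemma erase_inl (n k : ℕ) : (padeIndex n).erase (.inl k) =
    ((range (n + 1)).erase k).disjSum (range (n + 1)) := by
  ext (x | x) <;> simp [padeIndex]

lemma erase_inr (n k : ℕ) : (padeIndex n).erase (.inr k) =
    (range (n + 1)).disjSum ((range (n + 1)).erase k) := by
  ext (x | x) <;> simp [padeIndex]

lemma prod_lower_sub (k : ℕ) (c : ℂ) :
    ∏ i ∈ range k, (3 * k - 3 * ((k - 1 - i : ℕ) : ℂ) + c) = ∏ i ∈ range k, (3 * (i + 1) + c) := by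
  refine prod_congr rfl fun i hi => ?_
  have hi : 1 + i ≤ k := by simp at hi; omega
  rw [Nat.sub_sub, Nat.cast_sub hi]; push_cast; ring

lemma prod_upper_sub (k l : ℕ) (c : ℂ) :
    ∏ i ∈ range l, (3 * k - 3 * ((k + (i + 1) : ℕ) : ℂ) + c) =
      (-1) ^ l * ∏ i ∈ range l, (3 * (i + 1) - c) := by
  rw [← prod_neg_range]
  refine prod_congr rfl fun i hi => ?_
  push_cast; ring

lemma padeWeight_mul_prod (n : ℕ) (i : ℕ ⊕ ℕ) (hi : i ∈ padeIndex n) :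
    padeWeight n i * ∏ j ∈ (padeIndex n).erase i, ((padeNode i : ℂ) - padeNode j) =
      -(3 ^ n * (∏ i ∈ range n, (3 * (i + 1) - 1 : ℂ)) *
        ∏ i ∈ range n, (3 * (i + 1) + 1 : ℂ)) := by
  have fz : ∀ k : ℕ, (k.factorial : ℂ) ≠ 0 := fun k => by exact_mod_cast Nat.factorial_ne_zero k
  have sq : ∀ l : ℕ, ((-1 : ℂ) ^ l) * (-1) ^ l = 1 := fun l => by
    rw [← mul_pow]; norm_num
  rcases i with k | k
  · have hk : k ≤ n := by simp [padeIndex] at hi; omega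
    obtain ⟨l, rfl⟩ := Nat.exists_eq_add_of_le hk
    rw [erase_inl, prod_disjSum]
    have e1 : ∏ x ∈ (range (k + l + 1)).erase k,
        ((padeNode (Sum.inl k) : ℂ) - padeNode (Sum.inl x)) =
        (3 ^ k * k.factorial) * ((-1) ^ l * (3 ^ l * l.factorial)) := by
      rw [prod_erase_range]
      have h1 := prod_lower_sub k 0
      have h2 := prod_upper_sub k l 0
      simp only [add_zero, sub_zero] at h1 h2
      simp only [padeNode, Sum.elim_inl]
      rw [← prod_const_mul_succ, ← prod_const_mul_succ, ← h1, ← h2]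
      push_cast; rfl
    have e2 : ∏ x ∈ range (k + l + 1), ((padeNode (Sum.inl k) : ℂ) - padeNode (Sum.inr x)) =
        -((∏ i ∈ range k, (3 * (i + 1) - 1 : ℂ)) *
          ((-1) ^ l * ∏ i ∈ range l, (3 * (i + 1) + 1 : ℂ))) := by
      rw [prod_range_split]
      have h1 := prod_lower_sub k (-1)
      have h2 := prod_upper_sub k l (-1)
      simp only [← sub_eq_add_neg, sub_neg_eq_add] at h1 h2
      simp only [padeNode, Sum.elim_inl, Sum.elim_inr]
      rw [← h1, ← h2]
      push_cast
      simp only [sub_add_eq_sub_sub]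
      ring
    rw [e1, e2]
    have h := padeNum_mul (k + l) k (by omega)
    rw [Nat.add_sub_cancel_left] at h
    rw [mul_assoc (3 ^ (k + l)), ← h]
    simp only [padeWeight, Sum.elim_inl, padeCoeff, Nat.add_sub_cancel_left]
    have := fz k
    have := fz l
    field_simp
    rw [pow_add]
    linear_combination (-3 ^ k * 3 ^ l * (∏ i ∈ range k, (3 * (i + 1) - 1 : ℂ)) *
      (∏ i ∈ range l, (3 * (i + 1) + 1 : ℂ)) * (padeNum (k + l) k)) * sq l
  · have hk : k ≤ n := by simp [padeIndex] at hi; omega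
    obtain ⟨l, rfl⟩ := Nat.exists_eq_add_of_le hk
    rw [erase_inr, prod_disjSum]
    have e1 : ∏ x ∈ (range (k + l + 1)).erase k,
        ((padeNode (Sum.inr k) : ℂ) - padeNode (Sum.inr x)) =
        (3 ^ k * k.factorial) * ((-1) ^ l * (3 ^ l * l.factorial)) := by
      rw [prod_erase_range]
      have h1 := prod_lower_sub k 0
      have h2 := prod_upper_sub k l 0
      simp only [add_zero, sub_zero] at h1 h2
      simp only [padeNode, Sum.elim_inr]
      rw [← prod_const_mul_succ, ← prod_const_mul_succ, ← h1, ← h2]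
      push_cast
      simp only [add_sub_add_right_eq_sub]
    have e2 : ∏ x ∈ range (k + l + 1), ((padeNode (Sum.inr k) : ℂ) - padeNode (Sum.inl x)) =
        ((∏ i ∈ range k, (3 * (i + 1) + 1 : ℂ)) *
          ((-1) ^ l * ∏ i ∈ range l, (3 * (i + 1) - 1 : ℂ))) := by
      rw [prod_range_split]
      have h1 := prod_lower_sub k 1
      have h2 := prod_upper_sub k l 1
      simp only [padeNode, Sum.elim_inl, Sum.elim_inr]
      rw [← h1, ← h2]
      push_cast
      simp only [add_sub_right_comm]
      ring
    rw [e1, e2]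
    have h := padeNum_mul (k + l) l (by omega)
    rw [Nat.add_sub_cancel] at h
    rw [mul_assoc (3 ^ (k + l)), ← h]
    simp only [padeWeight, Sum.elim_inr, padeCoeff, Nat.add_sub_cancel_left, Nat.add_sub_cancel]
    have := fz k
    have := fz l
    field_simp
    rw [pow_add]
    linear_combination (-3 ^ k * 3 ^ l * (∏ i ∈ range l, (3 * (i + 1) - 1 : ℂ)) *
      (∏ i ∈ range k, (3 * (i + 1) + 1 : ℂ)) * (padeNum (k + l) l)) * sq l

lemma prod_mul_factorial (n : ℕ) : (3 ^ n * (∏ i ∈ range n, (3 * (i + 1) - 1 : ℂ)) *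
    ∏ i ∈ range n, (3 * (i + 1) + 1 : ℂ)) * n.factorial = (3 * n + 1).factorial := by
  induction n with
  | zero => simp
  | succ n ih =>
    rw [show 3 * (n + 1) + 1 = 3 * n + 1 + 1 + 1 + 1 by ring, Nat.factorial_succ (3 * n + 1 + 1 + 1),
      Nat.factorial_succ (3 * n + 1 + 1), Nat.factorial_succ (3 * n + 1), Nat.factorial_succ n,
      prod_range_succ, prod_range_succ]
    push_cast
    rw [← ih]; ring

lemma padeNode_injective : Function.Injective padeNode := by
  rintro (a | a) (b | b) h <;> simp [padeNode] at h ⊢ <;> omega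

lemma card_padeIndex (n : ℕ) : #(padeIndex n) = 2 * n + 1 + 1 := by
  simp [padeIndex]; ring

/-- The moments of the weights. -/
lemma sum_padeWeight_eval (n : ℕ) (P : Polynomial ℂ) (hP : P.natDegree ≤ 2 * n + 1) :
    ∑ i ∈ padeIndex n, padeWeight n i * P.eval (padeNode i : ℂ) =
      -((3 * n + 1).factorial / n.factorial) * P.coeff (2 * n + 1) := by
  have h := Lagrange.coeff_eq_sum (s := padeIndex n) (v := fun i => (padeNode i : ℂ)) (P := P)
    (fun a _ b _ h => padeNode_injective (Nat.cast_injective h)) (by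
      rw [card_padeIndex]
      exact (Polynomial.degree_le_of_natDegree_le hP).trans_lt
        (by exact_mod_cast Nat.lt_succ_self (2 * n + 1)))
  rw [card_padeIndex, Nat.add_sub_cancel] at h
  rw [h, mul_sum]
  refine sum_congr rfl fun i hi => ?_
  have h1 := padeWeight_mul_prod n i hi
  have fz : (n.factorial : ℂ) ≠ 0 := by exact_mod_cast Nat.factorial_ne_zero n
  have h2 := prod_mul_factorial n
  rw [← h2, mul_div_cancel_right₀ _ fz, ← h1]
  have h3 : ∏ j ∈ (padeIndex n).erase i, ((padeNode i : ℂ) - padeNode j) ≠ 0 := by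
    rw [prod_ne_zero_iff]
    intro j hj
    rw [sub_ne_zero]
    exact fun h => Finset.ne_of_mem_erase hj (padeNode_injective (by exact_mod_cast h.symm))
  field_simp

/-- An exponential sum whose first `N` moments vanish is of size `O(φ ^ N)`, if it has `N + 1`
terms. -/
lemma norm_sum_exp_le {ι : Type*} [DecidableEq ι] (N : ℕ) (s : Finset ι) (hs : #s = N + 1)
    (c : ι → ℂ) (e : ι → ℝ) (h0 : ∀ j < N, ∑ i ∈ s, c i * (e i : ℂ) ^ j = 0) {φ : ℝ} (hφ : 0 ≤ φ) :
    ‖∑ i ∈ s, c i * Complex.exp (e i * φ * Complex.I)‖ ≤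
      ‖∑ i ∈ s, c i * (e i : ℂ) ^ N‖ * φ ^ N / N.factorial := by
  induction N generalizing s c φ with
  | zero =>
    obtain ⟨a, rfl⟩ := card_eq_one.1 hs
    simp only [sum_singleton, norm_mul, pow_zero, mul_one, Nat.factorial_zero, Nat.cast_one,
      div_one]
    rw [← Complex.ofReal_mul, Complex.norm_exp_ofReal_mul_I, mul_one]
  | succ N ih =>
    obtain ⟨a, ha⟩ : s.Nonempty := card_pos.1 (by omega)
    set M := ‖∑ i ∈ s, c i * (e i : ℂ) ^ (N + 1)‖ with hM
    let g : ℝ → ℂ := fun x => ∑ i ∈ s, c i * Complex.exp ((e i - e a) * x * Complex.I)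
    let c' : ι → ℂ := fun i => c i * ((e i - e a) * Complex.I)
    have hc' : ∀ j, ∑ i ∈ s.erase a, c' i * (e i : ℂ) ^ j =
        Complex.I * (∑ i ∈ s, c i * (e i : ℂ) ^ (j + 1) - e a * ∑ i ∈ s, c i * (e i : ℂ) ^ j) := by
      intro j
      rw [sum_erase _ (by simp [c']), mul_sum, ← sum_sub_distrib, mul_sum]
      refine sum_congr rfl fun i _ => ?_
      simp only [c']; ring
    have norm_eq : ∀ (t : Finset ι) (d : ι → ℂ) (x : ℝ),
        ‖∑ i ∈ t, d i * Complex.exp ((e i - e a) * x * Complex.I)‖ =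
        ‖∑ i ∈ t, d i * Complex.exp (e i * x * Complex.I)‖ := by
      intro t d x
      rw [← mul_one ‖∑ i ∈ t, d i * Complex.exp (e i * x * Complex.I)‖,
        ← Complex.norm_exp_ofReal_mul_I (-e a * x), ← norm_mul, sum_mul]
      congr 1
      refine sum_congr rfl fun i _ => ?_
      rw [mul_assoc (d i), ← Complex.exp_add]; congr 2; push_cast; ring
    have hderiv : ∀ x : ℝ, HasDerivAt g (∑ i ∈ s.erase a, c' i *
        Complex.exp ((e i - e a) * x * Complex.I)) x := by
      intro x
      rw [sum_erase _ (by simp [c'])]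
      refine HasDerivAt.fun_sum fun i _ => ?_
      have h1 : HasDerivAt (fun y : ℝ => ((e i - e a) * y * Complex.I : ℂ))
          ((e i - e a) * Complex.I) x := by
        have := ((hasDerivAt_id x).ofReal_comp).const_mul ((e i - e a : ℂ))
        simpa using this.mul_const Complex.I
      have h2 := (h1.cexp).const_mul (c i)
      refine h2.congr_deriv ?_
      simp only [c']; ring
    have hg0 : g 0 = 0 := by
      have := h0 0 (by omega)
      simpa [g] using this
    have hbound : ∀ x : ℝ, 0 ≤ x → ‖∑ i ∈ s.erase a, c' i *
        Complex.exp ((e i - e a) * x * Complex.I)‖ ≤ M * x ^ N / N.factorial := by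
      intro x hx
      rw [norm_eq]
      refine (ih (s.erase a) (by rw [card_erase_of_mem ha]; omega) c' (fun j hj => ?_) hx).trans
        (le_of_eq ?_)
      · rw [hc', h0 _ (by omega), h0 _ (by omega)]; simp
      · rw [hc', h0 N (by omega), mul_zero, sub_zero, norm_mul, Complex.norm_I, one_mul]
    have key := image_norm_le_of_norm_deriv_right_le_deriv_boundary (f := g) (a := 0) (b := φ)
      (B := fun x => M * x ^ (N + 1) / (N + 1).factorial) (B' := fun x => M * x ^ N / N.factorial)
      (f' := fun x => ∑ i ∈ s.erase a, c' i * Complex.exp ((e i - e a) * x * Complex.I))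
      (fun x _ => (hderiv x).continuousAt.continuousWithinAt)
      (fun x _ => (hderiv x).hasDerivWithinAt) (by simp [hg0])
      (fun x => by
        have := ((hasDerivAt_pow (N + 1) x).const_mul M).div_const ((N + 1).factorial : ℝ)
        refine this.congr_deriv ?_
        rw [Nat.factorial_succ]; push_cast
        have : (N.factorial : ℝ) ≠ 0 := by exact_mod_cast Nat.factorial_ne_zero N
        field_simp)
      (fun x hx => hbound x hx.1) (x := φ) ⟨hφ, le_rfl⟩
    rw [← norm_eq]
    exact key

/-- The numerator `α` of the Padé approximant. -/
noncomputable def padeA (n : ℕ) : ℂ[X] := ∑ k ∈ range (n + 1), C (padeCoeff n k) * X ^ k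

/-- The denominator `β` of the Padé approximant. -/
noncomputable def padeB (n : ℕ) : ℂ[X] := ∑ k ∈ range (n + 1), C (padeCoeff n (n - k)) * X ^ k

/-- The polynomial `α(s³) - s β(s³)`. -/
noncomputable def padeP (n : ℕ) : ℂ[X] := (padeA n).comp (X ^ 3) - X * (padeB n).comp (X ^ 3)

lemma padeP_eq_sum (n : ℕ) : padeP n = ∑ i ∈ padeIndex n, C (padeWeight n i) * X ^ padeNode i := by
  rw [padeP, padeA, padeB, padeIndex, sum_disjSum]
  simp only [Polynomial.sum_comp, mul_comp, C_comp, pow_comp, X_comp, ← pow_mul, padeWeight, padeNode,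
    Sum.elim_inl, Sum.elim_inr, mul_sum, C_neg, neg_mul, sum_neg_distrib, sub_eq_add_neg]
  congr 2
  refine sum_congr rfl fun k _ => ?_
  ring

lemma norm_padeP_eval_le (n : ℕ) (φ : ℝ) :
    ‖(padeP n).eval (Complex.exp (φ * Complex.I))‖ ≤
      ((3 * n + 1).choose n) * |φ| ^ (2 * n + 1) := by
  have main : ∀ ε : ℝ, |ε| = 1 → ‖(padeP n).eval (Complex.exp ((ε * |φ| : ℝ) * Complex.I))‖ ≤
      ((3 * n + 1).choose n) * |φ| ^ (2 * n + 1) := by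
    intro ε hε
    have hmom : ∀ j ≤ 2 * n + 1, ∑ i ∈ padeIndex n, padeWeight n i *
        ((ε * padeNode i : ℝ) : ℂ) ^ j = ε ^ j * (-((3 * n + 1).factorial / n.factorial) *
          ((X : ℂ[X]) ^ j).coeff (2 * n + 1)) := by
      intro j hj
      rw [← sum_padeWeight_eval n (X ^ j) (by rwa [natDegree_X_pow]), mul_sum]
      refine sum_congr rfl fun i _ => ?_
      rw [eval_pow, eval_X]; push_cast; ring
    have h := norm_sum_exp_le (2 * n + 1) (padeIndex n) (card_padeIndex n) (padeWeight n)
      (fun i => ε * padeNode i) (fun j hj => by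
        rw [hmom j hj.le, coeff_X_pow, if_neg (by omega)]; simp) (abs_nonneg φ)
    rw [hmom _ le_rfl, coeff_X_pow, if_pos rfl] at h
    have e : (padeP n).eval (Complex.exp ((ε * |φ| : ℝ) * Complex.I)) = ∑ i ∈ padeIndex n,
        padeWeight n i * Complex.exp (((ε * padeNode i : ℝ) : ℂ) * |φ| * Complex.I) := by
      rw [padeP_eq_sum, eval_finsetSum]
      refine sum_congr rfl fun i _ => ?_
      rw [eval_mul, eval_C, eval_pow, eval_X, ← Complex.exp_nat_mul]
      congr 2; push_cast; ring
    rw [e]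
    refine h.trans (le_of_eq ?_)
    rw [mul_one, norm_mul, norm_pow, Complex.norm_real, Real.norm_eq_abs, hε, one_pow, one_mul,
      norm_neg, norm_div, Complex.norm_natCast, Complex.norm_natCast,
      Nat.choose_eq_factorial_div_factorial (by omega : n ≤ 3 * n + 1), Nat.cast_div
        (Nat.factorial_mul_factorial_dvd_factorial (by omega)) (by positivity),
      show 3 * n + 1 - n = 2 * n + 1 by omega]
    push_cast
    field_simp
  rcases abs_choice φ with h | h
  · have := main 1 (by simp)
    rw [one_mul, h] at this
    rwa [h]
  · have := main (-1) (by simp)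
    rw [h] at this ⊢
    simpa using this

lemma X_sub_one_pow_dvd_padeP (n : ℕ) : (X - C 1) ^ (2 * n + 1) ∣ padeP n := by
  rw [X_sub_C_pow_dvd_iff, ← taylor_apply, X_pow_dvd_iff]
  intro j hj
  rw [taylor_coeff, padeP_eq_sum, map_sum, eval_finsetSum]
  have h := sum_padeWeight_eval n (descPochhammer ℂ j) (by rw [descPochhammer_natDegree]; omega)
  rw [coeff_eq_zero_of_natDegree_lt (by rw [descPochhammer_natDegree]; omega), mul_zero] at h
  have fz : (j.factorial : ℂ) ≠ 0 := by exact_mod_cast Nat.factorial_ne_zero j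
  refine (mul_eq_zero.1 ?_).resolve_left fz
  rw [← h, mul_sum]
  refine sum_congr rfl fun i _ => ?_
  rw [descPochhammer_eval_eq_descFactorial, Nat.descFactorial_eq_factorial_mul_choose,
    C_mul_X_pow_eq_monomial, hasseDeriv_monomial, eval_monomial]
  push_cast; ring

/-- If `D(X³)` vanishes at `1` to order `m` then so does `D`. -/
lemma X_sub_one_pow_dvd_of_comp {D : ℂ[X]} (hD : D ≠ 0) {m : ℕ}
    (h : (X - C 1) ^ m ∣ D.comp (X ^ 3)) : (X - C 1) ^ m ∣ D := by
  obtain ⟨q, hq, hq1⟩ := exists_eq_pow_rootMultiplicity_mul_and_not_dvd D hD 1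
  set r := D.rootMultiplicity 1 with hr
  rw [dvd_iff_isRoot, IsRoot.def] at hq1
  have hqc : ¬ (X - C 1) ∣ ((X ^ 2 + X + 1 : ℂ[X]) ^ r * q.comp (X ^ 3)) := by
    rw [dvd_iff_isRoot, IsRoot.def]
    simp [hq1]; norm_num
  have e : D.comp (X ^ 3) = (X - C 1) ^ r * ((X ^ 2 + X + 1 : ℂ[X]) ^ r * q.comp (X ^ 3)) := by
    rw [hq, mul_comp, pow_comp, ← mul_assoc, ← mul_pow]
    congr 2
    simp only [sub_comp, X_comp, map_one, one_comp]; ring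
  have hmr : m ≤ r := by
    by_contra! hlt
    rw [e] at h
    have h1 : (X - C 1 : ℂ[X]) ^ (r + 1) ∣ (X - C 1) ^ r *
      ((X ^ 2 + X + 1 : ℂ[X]) ^ r * q.comp (X ^ 3)) := (pow_dvd_pow _ hlt).trans h
    rw [pow_succ] at h1
    exact hqc ((mul_dvd_mul_iff_left (pow_ne_zero _ (X_sub_C_ne_zero 1))).1 h1)
  rw [hq]
  exact (pow_dvd_pow _ hmr).mul_right _

/-- The determinant of two consecutive Padé approximants. -/
noncomputable def padeD (n : ℕ) : ℂ[X] := padeA n * padeB (n + 1) - padeA (n + 1) * padeB n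

lemma natDegree_sum_C_mul_X_pow_le (n : ℕ) (c : ℕ → ℂ) :
    (∑ k ∈ range (n + 1), C (c k) * X ^ k).natDegree ≤ n := by
  refine natDegree_sum_le_of_forall_le _ _ fun k hk => ?_
  exact (natDegree_C_mul_X_pow_le _ _).trans (by simp at hk; omega)

lemma eval_zero_sum (n : ℕ) (c : ℕ → ℂ) :
    (∑ k ∈ range (n + 1), C (c k) * X ^ k).eval 0 = c 0 := by
  rw [sum_range_succ']
  simp [eval_finsetSum]

lemma padeD_ne_zero (n : ℕ) : padeD n ≠ 0 := by
  intro h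
  have h0 : (padeD n).eval 0 = 0 := by rw [h, eval_zero]
  rw [padeD, eval_sub, eval_mul, eval_mul, padeA, padeA, padeB, padeB, eval_zero_sum,
    eval_zero_sum, eval_zero_sum, eval_zero_sum] at h0
  have fz : ∀ k : ℕ, (k.factorial : ℂ) ≠ 0 := fun k => by exact_mod_cast Nat.factorial_ne_zero k
  simp only [padeCoeff, padeNum, Nat.sub_zero, Ioc_self, prod_empty, Nat.sub_self,
    Nat.factorial_zero, mul_one, one_mul, Nat.cast_one] at h0
  rw [← Finset.insert_Ioc_right_eq_Ioc_add_one (Nat.zero_le n), prod_insert (by simp),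
    prod_insert (by simp)] at h0
  have hU : (∏ j ∈ Ioc 0 n, (3 * j - 1) : ℕ) ≠ 0 := by
    rw [prod_ne_zero_iff]; intro j hj; simp at hj; omega
  have hV : (∏ j ∈ Ioc 0 n, (3 * j + 1) : ℕ) ≠ 0 := by
    rw [prod_ne_zero_iff]; intro j hj; omega
  generalize ∏ j ∈ Ioc 0 n, (3 * j - 1) = U at *
  generalize ∏ j ∈ Ioc 0 n, (3 * j + 1) = V at *
  rw [show 3 * (n + 1) - 1 = 3 * n + 2 by omega] at h0
  have := fz n
  have := fz (n + 1)
  field_simp at h0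
  push_cast at h0
  have hU' : (U : ℂ) ≠ 0 := by exact_mod_cast hU
  have hV' : (V : ℂ) ≠ 0 := by exact_mod_cast hV
  have : (U : ℂ) * V * 2 = 0 := by linear_combination h0
  simp [hU', hV'] at this

lemma padeD_eval_ne_zero (n : ℕ) {t : ℂ} (ht : t ≠ 1) : (padeD n).eval t ≠ 0 := by
  intro h
  have h1 : (X - C 1) ^ (2 * n + 1) ∣ padeD n := by
    refine X_sub_one_pow_dvd_of_comp (padeD_ne_zero n) ?_
    have e : (padeD n).comp (X ^ 3) = padeP n * (padeB (n + 1)).comp (X ^ 3) -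
        padeP (n + 1) * (padeB n).comp (X ^ 3) := by
      rw [padeD, padeP, padeP, sub_comp, mul_comp, mul_comp]; ring
    rw [e]
    refine dvd_sub ((X_sub_one_pow_dvd_padeP n).mul_right _) (Dvd.dvd.mul_right ?_ _)
    exact (pow_dvd_pow _ (by omega)).trans (X_sub_one_pow_dvd_padeP (n + 1))
  have h2 : (X - C t) ∣ padeD n := dvd_iff_isRoot.2 h
  have h3 : (X - C 1) ^ (2 * n + 1) * (X - C t) ∣ padeD n := by
    refine IsCoprime.mul_dvd ?_ h1 h2
    exact (isCoprime_X_sub_C_of_isUnit_sub (sub_ne_zero.2 ht.symm).isUnit).pow_left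
  have h4 := natDegree_le_of_dvd h3 (padeD_ne_zero n)
  rw [natDegree_mul (pow_ne_zero _ (X_sub_C_ne_zero _)) (X_sub_C_ne_zero _), natDegree_pow,
    natDegree_X_sub_C, natDegree_X_sub_C] at h4
  have h5 : (padeD n).natDegree ≤ 2 * n + 1 := by
    refine (natDegree_sub_le _ _).trans (max_le ?_ ?_) <;> refine natDegree_mul_le.trans ?_
    · have := natDegree_sum_C_mul_X_pow_le n (fun k => padeCoeff n k)
      have := natDegree_sum_C_mul_X_pow_le (n + 1) (fun k => padeCoeff (n + 1) (n + 1 - k))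
      simp only [padeA, padeB]; omega
    · have := natDegree_sum_C_mul_X_pow_le (n + 1) (fun k => padeCoeff (n + 1) k)
      have := natDegree_sum_C_mul_X_pow_le n (fun k => padeCoeff n (n - k))
      simp only [padeA, padeB]; omega
  omega

/-- A primitive cube root of unity. -/
noncomputable def omega : ℂ := ⟨-1 / 2, √3 / 2⟩

lemma omega_sq : omega ^ 2 = -omega - 1 := by
  have h : √3 * √3 = 3 := Real.mul_self_sqrt (by norm_num)
  apply Complex.ext <;> simp [omega, sq]
  · linear_combination (-1 / 4 : ℝ) * h
  · ring

/-- The ring of Eisenstein integers. -/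
noncomputable def eisenstein : Subring ℂ where
  carrier := {x | ∃ a b : ℤ, x = a + b * omega}
  mul_mem' := by
    rintro _ _ ⟨a, b, rfl⟩ ⟨c, d, rfl⟩
    refine ⟨a * c - b * d, a * d + b * c - b * d, ?_⟩
    push_cast
    linear_combination (b * d : ℂ) * omega_sq
  one_mem' := ⟨1, 0, by simp⟩
  add_mem' := by
    rintro _ _ ⟨a, b, rfl⟩ ⟨c, d, rfl⟩
    exact ⟨a + c, b + d, by push_cast; ring⟩
  zero_mem' := ⟨0, 0, by simp⟩
  neg_mem' := by
    rintro _ ⟨a, b, rfl⟩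
    exact ⟨-a, -b, by push_cast; ring⟩

lemma omega_mem : omega ∈ eisenstein := ⟨0, 1, by simp⟩

lemma normSq_add_mul_omega (a b : ℝ) :
    Complex.normSq (a + b * omega) = a ^ 2 - a * b + b ^ 2 := by
  have h : √3 * √3 = 3 := Real.mul_self_sqrt (by norm_num)
  simp [omega, Complex.normSq_apply]
  linear_combination (b ^ 2 / 4 : ℝ) * h

lemma one_le_norm_of_mem {x : ℂ} (hx : x ∈ eisenstein) (h0 : x ≠ 0) : 1 ≤ ‖x‖ := by
  obtain ⟨a, b, rfl⟩ := hx
  have h1 : 0 < Complex.normSq ((a : ℂ) + b * omega) := Complex.normSq_pos.2 h0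
  have h2 := normSq_add_mul_omega a b
  push_cast at h2
  have h3 : (1 : ℝ) ≤ Complex.normSq ((a : ℂ) + b * omega) := by
    rw [h2] at h1 ⊢
    have : 0 < a ^ 2 - a * b + b ^ 2 := by exact_mod_cast h1
    exact_mod_cast (by omega : 1 ≤ a ^ 2 - a * b + b ^ 2)
  rw [Complex.normSq_eq_norm_sq] at h3
  nlinarith [norm_nonneg ((a : ℂ) + b * omega)]

lemma conj_omega : (starRingEnd ℂ) omega = -omega - 1 := by
  apply Complex.ext <;> simp [omega]; norm_num

lemma conj_mem {x : ℂ} (hx : x ∈ eisenstein) : (starRingEnd ℂ) x ∈ eisenstein := by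
  obtain ⟨a, b, rfl⟩ := hx
  rw [map_add, map_mul, conj_omega, map_intCast, map_intCast]
  exact ⟨a - b, -b, by push_cast; ring⟩

lemma exists_mul_sum_mem {ι : Type*} (S : Submonoid ℕ) (s : Finset ι) (g : ι → ℂ)
    (h : ∀ i ∈ s, ∃ L ∈ S, (L : ℂ) * g i ∈ eisenstein) :
    ∃ L ∈ S, (L : ℂ) * ∑ i ∈ s, g i ∈ eisenstein := by
  classical
  induction s using Finset.induction_on with
  | empty => exact ⟨1, one_mem _, by simp⟩
  | insert a s ha ih =>
    obtain ⟨L, hL, h1⟩ := ih fun i hi => h i (mem_insert_of_mem hi)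
    obtain ⟨L', hL', h2⟩ := h a (mem_insert_self _ _)
    refine ⟨L * L', mul_mem hL hL', ?_⟩
    rw [sum_insert ha]
    have e : ((L * L' : ℕ) : ℂ) * (g a + ∑ i ∈ s, g i) =
        L * (L' * g a) + L' * (L * ∑ i ∈ s, g i) := by push_cast; ring
    rw [e]
    exact add_mem (mul_mem (natCast_mem _ _) h2) (mul_mem (natCast_mem _ _) h1)

lemma mem_of_coprime_mul_mem {x : ℂ} {a b : ℕ} (hab : a.Coprime b)
    (ha : (a : ℂ) * x ∈ eisenstein) (hb : (b : ℂ) * x ∈ eisenstein) : x ∈ eisenstein := by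
  obtain ⟨u, v, h⟩ := Nat.isCoprime_iff_coprime.2 hab
  have h' : (u * a + v * b : ℂ) = 1 := by exact_mod_cast h
  have e : x = u * (a * x) + v * (b * x) := by linear_combination (-x) * h'
  rw [e]
  exact add_mem (mul_mem (intCast_mem _ _) ha) (mul_mem (intCast_mem _ _) hb)

lemma prod_Ioc_eq_prod_range_sub (g : ℕ → ℕ) {k n : ℕ} (h : k ≤ n) :
    ∏ j ∈ Ioc k n, g j = ∏ i ∈ range (n - k), g (n - i) := by
  induction n, h using Nat.le_induction with
  | base => simp
  | succ n h ih =>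
    rw [← Finset.insert_Ioc_right_eq_Ioc_add_one h, prod_insert (by simp), ih,
      Nat.succ_sub h, prod_range_succ', mul_comm]
    simp

lemma choose_eq_prod_div (a : ℂ) (n : ℕ) :
    Ring.choose a n = (∏ i ∈ range n, (a - i)) / n.factorial := by
  have h : (descPochhammer ℤ n).smeval a = ∏ i ∈ range n, (a - i) := by
    induction n with
    | zero => simp [descPochhammer_zero, smeval_one]
    | succ n ih =>
      rw [descPochhammer_succ_right, smeval_mul, ih, prod_range_succ, smeval_sub, smeval_X,
        smeval_natCast]
      simp
  have fz : (n.factorial : ℂ) ≠ 0 := by exact_mod_cast Nat.factorial_ne_zero n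
  rw [eq_div_iff fz, ← h, Ring.descPochhammer_eq_factorial_smul_choose, nsmul_eq_mul, mul_comm]

lemma three_pow_mul_choose (n m : ℕ) (h : m ≤ n) : (3 : ℂ) ^ m * Ring.choose (n + 1 / 3 : ℂ) m =
    ((∏ j ∈ Ioc (n - m) n, (3 * j + 1) : ℕ) : ℂ) / m.factorial := by
  rw [choose_eq_prod_div, prod_Ioc_eq_prod_range_sub _ (Nat.sub_le _ _), Nat.sub_sub_self h,
    ← mul_div_assoc, show (3 : ℂ) ^ m = ∏ _i ∈ range m, 3 by simp, ← prod_mul_distrib]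
  congr 1
  push_cast
  refine prod_congr rfl fun i hi => ?_
  rw [Nat.cast_sub (by simp at hi; omega)]; ring

lemma three_pow_mul_choose' (n m : ℕ) (h : m ≤ n) : (3 : ℂ) ^ m * Ring.choose (n - 1 / 3 : ℂ) m =
    ((∏ j ∈ Ioc (n - m) n, (3 * j - 1) : ℕ) : ℂ) / m.factorial := by
  rw [choose_eq_prod_div, prod_Ioc_eq_prod_range_sub _ (Nat.sub_le _ _), Nat.sub_sub_self h,
    ← mul_div_assoc, show (3 : ℂ) ^ m = ∏ _i ∈ range m, 3 by simp, ← prod_mul_distrib]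
  congr 1
  push_cast
  refine prod_congr rfl fun i hi => ?_
  simp at hi
  rw [Nat.cast_sub (by omega)]; push_cast; rw [Nat.cast_sub (by omega)]; ring

lemma padeCoeff_eq_choose {n k : ℕ} (h : k ≤ n) : padeCoeff n k =
    3 ^ n * (Ring.choose (n - 1 / 3 : ℂ) (n - k) * Ring.choose (n + 1 / 3 : ℂ) k) := by
  have h1 := three_pow_mul_choose n k h
  have h2 := three_pow_mul_choose' n (n - k) (Nat.sub_le _ _)
  rw [Nat.sub_sub_self h] at h2
  have e : (3 : ℂ) ^ n = 3 ^ (n - k) * 3 ^ k := by rw [← pow_add]; congr 1; omega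
  rw [padeCoeff, padeNum, Nat.cast_mul, e]
  rw [show ∀ a b c d : ℂ, a * b * (c * d) = (a * c) * (b * d) by intros; ring, h1, h2,
    div_mul_div_comm]
  rw [mul_comm (k.factorial : ℂ)]

/-- The homogenization of the numerator of the Padé approximant. -/
noncomputable def padeForm (n : ℕ) (X Y : ℂ) : ℂ :=
  ∑ k ∈ range (n + 1), padeCoeff n k * (X ^ (n - k) * Y ^ k)

lemma padeForm_expand (n : ℕ) (X Y : ℂ) : padeForm n X Y = ∑ m ∈ range (n + 1),
    (3 ^ n * Ring.choose (n + 1 / 3 : ℂ) m) * (X - Y) ^ m *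
      ((-1) ^ m * ((2 * n - m).choose (n - m) : ℂ) * X ^ (n - m)) := by
  have h1 : padeForm n X Y = ∑ m ∈ range (n + 1), ∑ k ∈ range (n + 1),
      padeCoeff n k * (k.choose m : ℂ) * ((-(X - Y)) ^ m * X ^ (n - m)) := by
    rw [sum_comm, padeForm]
    refine sum_congr rfl fun k hk => ?_
    have hk : k ≤ n := by simp at hk; omega
    have hY : Y ^ k = ∑ m ∈ range (n + 1), (-(X - Y)) ^ m * X ^ (k - m) * (k.choose m : ℂ) := by
      conv_lhs => rw [show Y = -(X - Y) + X by ring, add_pow]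
      refine sum_subset (by simpa using hk) fun m _ hm => ?_
      rw [Nat.choose_eq_zero_of_lt (by simp at hm; omega)]; simp
    rw [hY, mul_sum, mul_sum]
    refine sum_congr rfl fun m hm => ?_
    by_cases hmk : m ≤ k
    · rw [show n - m = (n - k) + (k - m) by omega, pow_add]; ring
    · rw [Nat.choose_eq_zero_of_lt (by omega)]; simp
  rw [h1]
  refine sum_congr rfl fun m hm => ?_
  have hm : m ≤ n := by simp at hm; omega
  obtain ⟨l, rfl⟩ := Nat.exists_eq_add_of_le hm
  have h2 : ∑ k ∈ range (m + l + 1), padeCoeff (m + l) k * (k.choose m : ℂ) =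
      3 ^ (m + l) * Ring.choose ((m + l : ℕ) + 1 / 3 : ℂ) m *
        ((2 * (m + l) - m).choose (m + l - m) : ℂ) := by
    rw [add_assoc, sum_range_add, sum_eq_zero, zero_add]
    · rw [Nat.add_sub_cancel_left, show 2 * (m + l) - m = m + 2 * l by omega,
        ← Ring.choose_natCast (R := ℂ), show ((m + 2 * l : ℕ) : ℂ) =
        (((m + l : ℕ) + 1 / 3) - m) + ((m + l : ℕ) - 1 / 3) by push_cast; ring,
        Ring.add_choose_eq (r := ((m + l : ℕ) + 1 / 3 - m : ℂ)) (s := ((m + l : ℕ) - 1 / 3 : ℂ)) _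
          (Commute.all _ _), Nat.sum_antidiagonal_eq_sum_range_succ_mk, mul_sum]
      refine sum_congr rfl fun j hj => ?_
      have hj : j ≤ l := by simp at hj; omega
      have h3 := Ring.choose_smul_choose ((m + l : ℕ) + 1 / 3 : ℂ) (Nat.le_add_right m j)
      rw [nsmul_eq_mul, Nat.add_sub_cancel_left] at h3
      rw [padeCoeff_eq_choose (by omega), show m + l - (m + j) = l - j by omega]
      linear_combination (3 ^ (m + l) * Ring.choose ((m + l : ℕ) - 1 / 3 : ℂ) (l - j)) * h3
    · intro k hk
      rw [Nat.choose_eq_zero_of_lt (by simpa using hk)]; simp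
  rw [← sum_mul, h2, neg_pow]; ring

lemma two_mul_factorization_factorial_le (m : ℕ) : 2 * m.factorial.factorization 3 ≤ m := by
  have : Fact (Nat.Prime 3) := ⟨Nat.prime_three⟩
  have h := sub_one_mul_padicValNat_factorial (p := 3) m
  rw [Nat.factorization_def _ Nat.prime_three]
  omega

/-- The natural numbers prime to `3`. -/
def coprimeThree : Submonoid ℕ where
  carrier := {L | L.Coprime 3}
  mul_mem' h h' := Nat.Coprime.mul_left h h'
  one_mem' := Nat.coprime_one_left 3

lemma padeForm_mem_of_sq (n : ℕ) {X Y : ℂ} (hX : X ∈ eisenstein) (hY : Y ∈ eisenstein)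
    (h : (X - Y) ^ 2 = -3) : ∃ L : ℕ, L.Coprime 3 ∧ (L : ℂ) * padeForm n X Y ∈ eisenstein := by
  rw [padeForm_expand]
  refine exists_mul_sum_mem coprimeThree _ _ fun m hm => ?_
  have hm : m ≤ n := by simp at hm; omega
  have fz : m.factorial ≠ 0 := Nat.factorial_ne_zero m
  refine ⟨m.factorial / 3 ^ m.factorial.factorization 3,
    (Nat.coprime_ordCompl Nat.prime_three fz).symm, ?_⟩
  have hv := two_mul_factorization_factorial_le m
  have e1 := Nat.ordProj_mul_ordCompl_eq_self m.factorial 3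
  have e2 := three_pow_mul_choose n m hm
  generalize m.factorial / 3 ^ m.factorial.factorization 3 = L at *
  have fz' : (m.factorial : ℂ) ≠ 0 := by exact_mod_cast fz
  have e1' : (3 : ℂ) ^ m.factorial.factorization 3 * L = m.factorial := by exact_mod_cast e1
  generalize m.factorial.factorization 3 = v at *
  obtain ⟨w, rfl⟩ := Nat.exists_eq_add_of_le hv
  obtain ⟨l, rfl⟩ := Nat.exists_eq_add_of_le hm
  have e3 : (X - Y) ^ (2 * v + w) = (-1) ^ v * 3 ^ v * (X - Y) ^ w := by
    rw [pow_add, pow_mul, h, ← mul_pow]; norm_num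
  rw [eq_div_iff fz'] at e2
  have e4 : (L : ℂ) * (3 ^ (2 * v + w + l) * Ring.choose ((2 * v + w + l : ℕ) + 1 / 3 : ℂ)
      (2 * v + w) * (X - Y) ^ (2 * v + w)) = 3 ^ l *
      ((∏ j ∈ Ioc (2 * v + w + l - (2 * v + w)) (2 * v + w + l), (3 * j + 1) : ℕ) : ℂ) *
      (-1) ^ v * (X - Y) ^ w := by
    rw [e3, ← e2, pow_add _ (2 * v + w) l, ← e1']
    ring
  rw [← mul_assoc, e4]
  have hZ : X - Y ∈ eisenstein := sub_mem hX hY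
  have h3 : (3 : ℂ) ∈ eisenstein := by exact_mod_cast natCast_mem eisenstein 3
  have hn1 : (-1 : ℂ) ∈ eisenstein := neg_mem (one_mem _)
  refine mul_mem (mul_mem (mul_mem (mul_mem ?_ ?_) ?_) ?_) (mul_mem (mul_mem ?_ ?_) ?_)
  · exact pow_mem h3 _
  · exact natCast_mem _ _
  · exact pow_mem hn1 _
  · exact pow_mem hZ _
  · exact pow_mem hn1 _
  · exact natCast_mem _ _
  · exact pow_mem hX _

lemma exists_three_pow_padeForm_mem {N n : ℕ} (hn : n = 4 * N ∨ n = 4 * N + 1) {X Y : ℂ}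
    (hX : X ∈ eisenstein) (hY : Y ∈ eisenstein) : ∃ M : ℕ, ((3 ^ M : ℕ) : ℂ) *
      ((4 * N + 1) * ((4 * N).factorial * (3 * N).factorial) /
        ((6 * N).factorial * N.factorial) * padeForm n X Y) ∈ eisenstein := by
  obtain ⟨L, ⟨M, rfl⟩, hL⟩ := exists_mul_sum_mem (Submonoid.powers 3) (range (n + 1))
    (fun k => (4 * N + 1) * ((4 * N).factorial * (3 * N).factorial) /
        ((6 * N).factorial * N.factorial) * (padeCoeff n k * (X ^ (n - k) * Y ^ k))) (by
      intro k hk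
      have hk : k ≤ n := by simp at hk; omega
      obtain ⟨M, q, hM⟩ := content_dvd hn hk
      refine ⟨3 ^ M, ⟨M, rfl⟩, ?_⟩
      have fz : ∀ k : ℕ, (k.factorial : ℂ) ≠ 0 :=
        fun k => by exact_mod_cast Nat.factorial_ne_zero k
      have hM' : (3 ^ M * ((4 * N + 1) * padeNum n k *
        ((4 * N).factorial * (3 * N).factorial)) : ℂ) = (6 * N).factorial * N.factorial *
          (k.factorial * (n - k).factorial) * q := by exact_mod_cast hM
      have e : ((3 ^ M : ℕ) : ℂ) * ((4 * N + 1) * ((4 * N).factorial * (3 * N).factorial) /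
        ((6 * N).factorial * N.factorial) * (padeCoeff n k * (X ^ (n - k) * Y ^ k))) =
          q * (X ^ (n - k) * Y ^ k) := by
        rw [padeCoeff, ← mul_assoc, ← mul_assoc]
        congr 1
        have := fz (6 * N); have := fz N; have := fz k; have := fz (n - k)
        field_simp
        push_cast
        linear_combination hM'
      rw [e]
      exact mul_mem (natCast_mem _ _) (mul_mem (pow_mem hX _) (pow_mem hY _)))
  refine ⟨M, ?_⟩
  rw [padeForm, mul_sum]
  exact hL

/-- The content of the Padé forms: up to a factor of size `O(N²)`, the Padé forms of degree `4N`
and `4N+1` are divisible by `(6N)! N! / ((4N)! (3N)!)`. -/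
lemma exists_padeForm_mem {N : ℕ} (hN : 0 < N) : ∃ r : ℕ, 3 ^ r ≤ 6 * N ∧
    ∀ n, n = 4 * N ∨ n = 4 * N + 1 → ∀ X ∈ eisenstein, ∀ Y ∈ eisenstein, (X - Y) ^ 2 = -3 →
    (4 * N + 1) * 3 ^ r * ((4 * N).factorial * (3 * N).factorial) /
        ((6 * N).factorial * N.factorial) * padeForm n X Y ∈ eisenstein := by
  obtain ⟨r, L, hr, hL, q, hq⟩ := ratio_three_part N hN
  refine ⟨r, hr, fun n hn X hX Y hY h => ?_⟩
  obtain ⟨M, hM⟩ := exists_three_pow_padeForm_mem hn hX hY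
  obtain ⟨L', hL', hm⟩ := padeForm_mem_of_sq n hX hY h
  have h3 : (3 : ℂ) ∈ eisenstein := by exact_mod_cast natCast_mem eisenstein 3
  refine mem_of_coprime_mul_mem (a := 3 ^ M) (b := L * L')
    (Nat.Coprime.pow_left _ (Nat.Coprime.mul_left hL hL').symm) ?_ ?_
  · have := mul_mem (pow_mem h3 r) hM
    convert this using 1
    ring
  · have fz : ∀ k : ℕ, (k.factorial : ℂ) ≠ 0 :=
      fun k => by exact_mod_cast Nat.factorial_ne_zero k
    have hq' : (L * (3 ^ r * ((4 * N).factorial * (3 * N).factorial)) : ℂ) =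
        (6 * N).factorial * N.factorial * q := by exact_mod_cast hq
    have := mul_mem (mul_mem (natCast_mem eisenstein (4 * N + 1)) (natCast_mem eisenstein q)) hm
    convert this using 1
    have := fz (6 * N); have := fz N
    push_cast
    field_simp
    linear_combination ((4 * N + 1) * L' * padeForm n X Y : ℂ) * hq'

lemma omega_pow_three : omega ^ 3 = 1 := by linear_combination (omega - 1) * omega_sq

lemma norm_omega : ‖omega‖ = 1 := by
  have : ‖omega‖ ^ 3 = 1 := by rw [← norm_pow, omega_pow_three, norm_one]
  exact (pow_eq_one_iff_of_nonneg (norm_nonneg _) (by norm_num)).1 this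

lemma two_sub_omega_mul : (2 - omega) * (3 + omega) = 7 := by linear_combination -omega_sq

lemma two_sub_omega_ne_zero : (2 - omega : ℂ) ≠ 0 := fun h => by
  simpa [h] using two_sub_omega_mul

lemma three_add_omega_ne_zero : (3 + omega : ℂ) ≠ 0 := fun h => by
  simpa [h] using two_sub_omega_mul

lemma content_ratio_ge {N : ℕ} (hN : 1 ≤ N) : (2 / 5 : ℝ) * (27 / 4) ^ N * (1 + 1 / (N + 1)) *
    ((4 * N).factorial * (3 * N).factorial) ≤ (6 * N).factorial * N.factorial := by
  induction N, hN using Nat.le_induction with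
  | base => norm_num [Nat.factorial]
  | succ N hN ih =>
    have e6 : ((6 * (N + 1)).factorial : ℝ) = (6 * N + 6) * (6 * N + 5) * (6 * N + 4) *
        (6 * N + 3) * (6 * N + 2) * (6 * N + 1) * (6 * N).factorial := by
      rw [show 6 * (N + 1) = 6 * N + 1 + 1 + 1 + 1 + 1 + 1 by ring]
      simp only [Nat.factorial_succ]; push_cast; ring
    have e4 : ((4 * (N + 1)).factorial : ℝ) = (4 * N + 4) * (4 * N + 3) * (4 * N + 2) *
        (4 * N + 1) * (4 * N).factorial := by
      rw [show 4 * (N + 1) = 4 * N + 1 + 1 + 1 + 1 by ring]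
      simp only [Nat.factorial_succ]; push_cast; ring
    have e3 : ((3 * (N + 1)).factorial : ℝ) = (3 * N + 3) * (3 * N + 2) * (3 * N + 1) *
        (3 * N).factorial := by
      rw [show 3 * (N + 1) = 3 * N + 1 + 1 + 1 by ring]
      simp only [Nat.factorial_succ]; push_cast; ring
    have e1 : ((N + 1).factorial : ℝ) = (N + 1) * N.factorial := by
      rw [Nat.factorial_succ]; push_cast; ring
    rw [e6, e4, e3, e1]
    have hx : (1 : ℝ) ≤ N := by exact_mod_cast hN
    push_cast
    generalize (N : ℝ) = x at *
    have hstep : (27 / 4 : ℝ) * (1 + 1 / (x + 1 + 1)) * ((4 * x + 4) * (4 * x + 3) * (4 * x + 2) *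
        (4 * x + 1) * ((3 * x + 3) * (3 * x + 2) * (3 * x + 1))) ≤ (1 + 1 / (x + 1)) *
        ((6 * x + 6) * (6 * x + 5) * (6 * x + 4) * (6 * x + 3) * (6 * x + 2) * (6 * x + 1) *
          (x + 1)) := by
      have h1 : (27 / 4 : ℝ) * ((x + 3) * (x + 1)) * ((4 * x + 3) * (4 * x + 1)) ≤
          (x + 2) ^ 2 * (3 * (6 * x + 5) * (6 * x + 1)) := by
        obtain ⟨y, rfl⟩ : ∃ y, x = y + 1 := ⟨x - 1, by ring⟩
        have hy : 0 ≤ y := by linarith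
        have : 0 ≤ y ^ 2 := sq_nonneg y
        have : 0 ≤ y ^ 3 := by positivity
        have : 0 ≤ y ^ 4 := by positivity
        nlinarith
      have e5 : (1 + 1 / (x + 1 + 1)) = (x + 3) / (x + 2) := by field_simp; ring
      have e6 : (1 + 1 / (x + 1)) = (x + 2) / (x + 1) := by field_simp; ring
      rw [e5, e6, ← sub_nonneg]
      have : 0 ≤ (24 * (x + 1) * (2 * x + 1) * (3 * x + 2) * (3 * x + 1) / (x + 2)) *
        ((x + 2) ^ 2 * (3 * (6 * x + 5) * (6 * x + 1)) -
        (27 / 4 : ℝ) * ((x + 3) * (x + 1)) * ((4 * x + 3) * (4 * x + 1))) :=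
        mul_nonneg (by positivity) (sub_nonneg.2 h1)
      refine this.trans (le_of_eq ?_)
      field_simp
      ring
    have hpos : (0 : ℝ) ≤ (2 / 5) * (27 / 4) ^ N *
      ((4 * N).factorial * (3 * N).factorial) := by positivity
    have hpos' : (0 : ℝ) < 1 + 1 / (x + 1) := by positivity
    have h2 := mul_le_mul_of_nonneg_right hstep hpos
    have h3 := mul_le_mul_of_nonneg_left ih (by positivity : (0 : ℝ) ≤
      (6 * x + 6) * (6 * x + 5) * (6 * x + 4) * (6 * x + 3) * (6 * x + 2) * (6 * x + 1) * (x + 1))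
    rw [pow_succ]
    calc _ = _ := ?_
      _ ≤ _ := h2
      _ = _ := ?_
      _ ≤ _ := h3
      _ = _ := ?_
    all_goals ring

lemma choose_three_mul_add_one_le (n : ℕ) :
    (((3 * n + 1).choose n : ℕ) : ℝ) ≤ 3 / 2 * (27 / 4) ^ n := by
  have key : ∀ n : ℕ, ((3 * n + 1).factorial : ℝ) ≤
      3 / 2 * (27 / 4) ^ n * (n.factorial * (2 * n + 1).factorial) := by
    intro n
    induction n with
    | zero => norm_num
    | succ n ih =>
      have e3 : ((3 * (n + 1) + 1).factorial : ℝ) = (3 * n + 4) * (3 * n + 3) * (3 * n + 2) *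
          (3 * n + 1).factorial := by
        rw [show 3 * (n + 1) + 1 = 3 * n + 1 + 1 + 1 + 1 by ring, Nat.factorial_succ,
          Nat.factorial_succ, Nat.factorial_succ (3 * n + 1)]; push_cast; ring
      have e2 : ((2 * (n + 1) + 1).factorial : ℝ) = (2 * n + 3) * (2 * n + 2) *
          (2 * n + 1).factorial := by
        rw [show 2 * (n + 1) + 1 = 2 * n + 1 + 1 + 1 by ring, Nat.factorial_succ,
          Nat.factorial_succ (2 * n + 1)]; push_cast; ring
      rw [e3, e2, Nat.factorial_succ n]
      have h1 : (3 * n + 4) * (3 * n + 3) * (3 * n + 2) ≤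
          (27 / 4 : ℝ) * ((n + 1) * ((2 * n + 3) * (2 * n + 2))) := by
        have : (0 : ℝ) ≤ n := by positivity
        have : (0 : ℝ) ≤ (n : ℝ) ^ 2 := by positivity
        nlinarith
      have h2 := mul_le_mul h1 ih (by positivity) (by positivity)
      push_cast
      rw [pow_succ]
      refine h2.trans (le_of_eq ?_)
      ring
  rw [Nat.choose_eq_factorial_div_factorial (by omega : n ≤ 3 * n + 1), Nat.cast_div
        (Nat.factorial_mul_factorial_dvd_factorial (by omega)) (by positivity),
      show 3 * n + 1 - n = 2 * n + 1 by omega, div_le_iff₀ (by positivity)]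
  push_cast
  exact key n

lemma norm_padeForm_le (n : ℕ) {X Y : ℂ} {H : ℝ} (hX : ‖X‖ = H) (hY : ‖Y‖ = H) :
    ‖padeForm n X Y‖ ≤ (12 * H) ^ n := by
  have hH : 0 ≤ H := hX ▸ norm_nonneg X
  have h1 : padeForm n 1 1 = 3 ^ n * ((2 * n).choose n : ℂ) := by
    rw [padeForm_expand, sum_range_succ', sum_eq_zero]
    · simp
    · intro m _; simp
  have hreal : ∀ k, padeCoeff n k = ((‖padeCoeff n k‖ : ℝ) : ℂ) := by
    intro k
    rw [padeCoeff, norm_div, norm_mul, Complex.norm_natCast, Complex.norm_natCast,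
      Complex.norm_natCast]
    push_cast; rfl
  have h2 : ∑ k ∈ range (n + 1), ‖padeCoeff n k‖ ≤ 12 ^ n := by
    have h3 : ∑ k ∈ range (n + 1), ‖padeCoeff n k‖ = 3 ^ n * ((2 * n).choose n : ℝ) := by
      have : ((∑ k ∈ range (n + 1), ‖padeCoeff n k‖ : ℝ) : ℂ) =
          ((3 ^ n * ((2 * n).choose n : ℝ) : ℝ) : ℂ) := by
        push_cast
        rw [← h1, padeForm]
        refine sum_congr rfl fun k _ => ?_
        rw [← hreal]; simp
      exact_mod_cast this
    rw [h3, show (12 : ℝ) ^ n = 3 ^ n * 2 ^ (2 * n) by rw [pow_mul, ← mul_pow]; norm_num]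
    have : ((2 * n).choose n : ℝ) ≤ 2 ^ (2 * n) := by exact_mod_cast Nat.choose_le_two_pow _ _
    gcongr
  calc ‖padeForm n X Y‖ ≤ ∑ k ∈ range (n + 1), ‖padeCoeff n k * (X ^ (n - k) * Y ^ k)‖ :=
        norm_sum_le _ _
    _ = ∑ k ∈ range (n + 1), ‖padeCoeff n k‖ * H ^ n := by
        refine sum_congr rfl fun k hk => ?_
        rw [norm_mul, norm_mul, norm_pow, norm_pow, hX, hY, ← pow_add]
        congr 2; simp at hk; omega
    _ = (∑ k ∈ range (n + 1), ‖padeCoeff n k‖) * H ^ n := by rw [sum_mul]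
    _ ≤ 12 ^ n * H ^ n := by gcongr
    _ = (12 * H) ^ n := by rw [mul_pow]

lemma padeForm_eq_eval_padeA (n : ℕ) {X : ℂ} (hX : X ≠ 0) (Y : ℂ) :
    padeForm n X Y = X ^ n * (padeA n).eval (Y / X) := by
  rw [padeForm, padeA, eval_finsetSum, mul_sum]
  refine sum_congr rfl fun k hk => ?_
  have hk : k ≤ n := by simp at hk; omega
  rw [eval_mul, eval_C, eval_pow, eval_X, div_pow]
  have : X ^ n = X ^ (n - k) * X ^ k := by rw [← pow_add]; congr 1; omega
  rw [this]; field_simp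

lemma padeForm_eq_eval_padeB (n : ℕ) {X : ℂ} (hX : X ≠ 0) (Y : ℂ) :
    padeForm n Y X = X ^ n * (padeB n).eval (Y / X) := by
  rw [padeForm, padeB, eval_finsetSum, mul_sum, ← sum_range_reflect]
  refine sum_congr rfl fun k hk => ?_
  have hk : k ≤ n := by simp at hk; omega
  rw [eval_mul, eval_C, eval_pow, eval_X, div_pow, Nat.add_sub_cancel, Nat.sub_sub_self hk]
  have : X ^ n = X ^ (n - k) * X ^ k := by rw [← pow_add]; congr 1; omega
  rw [this]; field_simp

/-- One of the cube roots of `s³` is close to `1` when `s³` is. -/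
lemma exists_omega_pow_mul_close (s : ℂ) : ∃ j : ℕ, ‖omega ^ j * s - 1‖ ≤ 4 / 3 * ‖1 - s ^ 3‖ := by
  have w2 := omega_sq
  have w3 := omega_pow_three
  have hw := norm_omega
  have h3 : ‖1 - omega‖ ^ 2 = 3 := by
    rw [← Complex.normSq_eq_norm_sq]
    have := normSq_add_mul_omega 1 (-1)
    rw [show (1 - omega : ℂ) = ((1 : ℝ) : ℂ) + ((-1 : ℝ) : ℂ) * omega by push_cast; ring, this]
    norm_num
  have e : 1 - s ^ 3 = (s - 1) * (omega * s - 1) * (omega ^ 2 * s - 1) * -1 := by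
    linear_combination (s ^ 3 - s ^ 2) * w3 + (- s ^ 2 + s) * w2
  have q01 : ‖1 - omega‖ ≤ ‖s - 1‖ + ‖omega * s - 1‖ := by
    have := norm_sub_le (omega * (s - 1)) (omega * s - 1)
    rw [norm_mul, hw, one_mul] at this
    rwa [show omega * (s - 1) - (omega * s - 1) = 1 - omega by ring] at this
  have q12 : ‖1 - omega‖ ≤ ‖omega * s - 1‖ + ‖omega ^ 2 * s - 1‖ := by
    have := norm_sub_le (omega * (omega * s - 1)) (omega ^ 2 * s - 1)
    rw [norm_mul, hw, one_mul] at this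
    rwa [show omega * (omega * s - 1) - (omega ^ 2 * s - 1) = 1 - omega by ring] at this
  have q20 : ‖1 - omega‖ ≤ ‖omega ^ 2 * s - 1‖ + ‖s - 1‖ := by
    have := norm_sub_le (omega * (omega ^ 2 * s - 1)) (s - 1)
    rw [norm_mul, hw, one_mul] at this
    rwa [show omega * (omega ^ 2 * s - 1) - (s - 1) = 1 - omega by
      linear_combination s * w3] at this
  rw [e, norm_mul, norm_mul, norm_mul, norm_neg, norm_one, mul_one]
  have key : ∀ c a b d : ℝ, 0 ≤ c → c ^ 2 = 3 → 0 ≤ a → a ≤ b → a ≤ d → c ≤ a + b → c ≤ a + d →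
      a ≤ 4 / 3 * (a * b * d) := by
    intro c a b d hc hc2 ha hab had h1 h2
    have hb : c / 2 ≤ b := by linarith
    have hd : c / 2 ≤ d := by linarith
    have : c / 2 * (c / 2) ≤ b * d := mul_le_mul hb hd (by positivity) (by linarith)
    have h4 : 3 / 4 ≤ b * d := by nlinarith
    nlinarith [mul_le_mul_of_nonneg_left h4 ha]
  have n0 := norm_nonneg (s - 1)
  have n1 := norm_nonneg (omega * s - 1)
  have n2 := norm_nonneg (omega ^ 2 * s - 1)
  have nc := norm_nonneg (1 - omega)
  rcases le_total ‖s - 1‖ ‖omega * s - 1‖ with h | h <;>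
    rcases le_total ‖omega * s - 1‖ ‖omega ^ 2 * s - 1‖ with h' | h' <;>
    rcases le_total ‖s - 1‖ ‖omega ^ 2 * s - 1‖ with h'' | h''
  all_goals first
    | (refine ⟨0, ?_⟩; rw [pow_zero, one_mul]
       exact key _ _ _ _ nc h3 n0 (by linarith) (by linarith) q01 (by linarith))
    | (refine ⟨1, ?_⟩; rw [pow_one]
       refine (key _ _ _ _ nc h3 n1 (by linarith) (by linarith) (by linarith) q12 :
         _ ≤ 4 / 3 * (‖omega * s - 1‖ * ‖s - 1‖ * ‖omega ^ 2 * s - 1‖)).trans (le_of_eq (by ring)))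
    | (refine ⟨2, ?_⟩
       refine (key _ _ _ _ nc h3 n2 (by linarith) (by linarith) q20 (by linarith) :
         _ ≤ 4 / 3 * (‖omega ^ 2 * s - 1‖ * ‖s - 1‖ * ‖omega * s - 1‖)).trans (le_of_eq (by ring)))

lemma norm_sq_add_mul_omega (x : ℂ) (a b : ℝ) (h : x = a + b * omega) :
    ‖x‖ ^ 2 = a ^ 2 - a * b + b ^ 2 := by
  rw [h, ← Complex.normSq_eq_norm_sq, normSq_add_mul_omega]

/-- The value `X` at the solution `(2, 1)` used as the base point of the approximation. -/
noncomputable def baseX : ℂ := omega - 18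

/-- The value `Y` at the solution `(2, 1)`. -/
noncomputable def baseY : ℂ := -omega - 19

lemma baseX_mem : baseX ∈ eisenstein := ⟨-18, 1, by push_cast [baseX]; ring⟩

lemma baseY_mem : baseY ∈ eisenstein := ⟨-19, -1, by push_cast [baseY]; ring⟩

lemma baseX_sub_baseY_sq : (baseX - baseY) ^ 2 = -3 := by
  rw [baseX, baseY]; linear_combination 4 * omega_sq

lemma norm_baseX_sq : ‖baseX‖ ^ 2 = 343 := by
  rw [norm_sq_add_mul_omega baseX (-18) 1 (by push_cast [baseX]; ring)]; norm_num

lemma norm_baseY : ‖baseY‖ = ‖baseX‖ := by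
  have : ‖baseY‖ ^ 2 = 343 := by
    rw [norm_sq_add_mul_omega baseY (-19) (-1) (by push_cast [baseY]; ring)]; norm_num
  exact (sq_eq_sq₀ (norm_nonneg _) (norm_nonneg _)).1 (this.trans norm_baseX_sq.symm)

lemma norm_baseX_pos : 0 < ‖baseX‖ := by
  have := norm_baseX_sq
  rcases (norm_nonneg baseX).lt_or_eq with h | h
  · exact h
  · rw [← h] at this; norm_num at this

lemma baseX_ne_zero : baseX ≠ 0 := norm_pos_iff.1 norm_baseX_pos

lemma norm_baseX_le : ‖baseX‖ ≤ 18.5203 := by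
  have := norm_baseX_sq
  nlinarith [norm_nonneg baseX]

lemma exists_exp_cube_eq : ∃ φ : ℝ,
    Complex.exp (φ * Complex.I) ^ 3 = baseY / baseX ∧ φ ^ 2 ≤ 0.00097835 := by
  set t := baseY / baseX with ht
  have h1 : ‖t‖ = 1 := by rw [ht, norm_div, norm_baseY, div_self norm_baseX_pos.ne']
  have hre : t.re = 683 / 686 := by
    have : t = 360 / 343 + 37 / 343 * omega := by
      rw [ht, div_eq_iff baseX_ne_zero, baseX, baseY]
      linear_combination -37 / 343 * omega_sq
    rw [this]
    simp [omega]
    norm_num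
  refine ⟨t.arg / 3, ?_, ?_⟩
  · rw [← Complex.exp_nat_mul]
    have := Complex.norm_mul_exp_arg_mul_I t
    rw [h1, Complex.ofReal_one, one_mul] at this
    refine Eq.trans ?_ this
    congr 1; push_cast; ring
  · have hc : Real.cos t.arg = 683 / 686 := by
      rw [Complex.cos_arg (by rw [← norm_pos_iff, h1]; norm_num), h1, hre, div_one]
    have hne : t.arg ≠ 0 := by
      intro h; rw [h, Real.cos_zero] at hc; norm_num at hc
    have hπ := Real.pi_pos
    have hlt := Real.cos_lt_one_div_sqrt_sq_add_one (x := t.arg)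
      (by linarith [Complex.neg_pi_lt_arg t]) (by linarith [Complex.arg_le_pi t]) hne
    rw [hc, lt_div_iff₀ (by positivity)] at hlt
    have hs : √(t.arg ^ 2 + 1) ≤ 686 / 683 := by linarith
    rw [Real.sqrt_le_left (by norm_num)] at hs
    rw [div_pow]
    norm_num at hs ⊢
    linarith

lemma baseT_ne_one : baseY / baseX ≠ 1 := by
  intro h
  rw [div_eq_one_iff_eq baseX_ne_zero] at h
  have := baseX_sub_baseY_sq
  rw [h] at this; norm_num at this

/-- `(3 + ω) z / ((2 - ω) z̄)` times a suitable cube root of unity is close to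
`exp (- φ i)`. -/
lemma exists_close {z s : ℂ} (hz : z ∈ eisenstein) (h0 : z ≠ 0)
    (h : (omega * (starRingEnd ℂ) z ^ 3 - omega ^ 2 * z ^ 3) ^ 2 = -3)
    (hs : s ^ 3 = baseY / baseX) : ∃ z' ∈ eisenstein, ‖z'‖ = ‖z‖ ∧
      ‖s * ((3 + omega) * z') / ((2 - omega) * (starRingEnd ℂ) z') - 1‖ ≤ 2.3095 / ‖z‖ ^ 3 := by
  have w2 := omega_sq
  have w3 := omega_pow_three
  have hconj : (starRingEnd ℂ) omega = omega ^ 2 := by rw [conj_omega, w2]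
  have hz0 := two_sub_omega_ne_zero
  have hc0 : (starRingEnd ℂ) z ≠ 0 := by simpa using h0
  have hw0 : omega ≠ 0 := by intro h; rw [h] at w3; norm_num at w3
  set s1 := s * ((3 + omega) * z) / ((2 - omega) * (starRingEnd ℂ) z) with hs1
  have h3 : 1 - s1 ^ 3 = (omega * (starRingEnd ℂ) z ^ 3 - omega ^ 2 * z ^ 3) /
      (omega * (starRingEnd ℂ) z ^ 3) := by
    have h30 : (3 + omega) ^ 3 = omega ^ 2 * baseX := by
      rw [baseX]; linear_combination 27 * w2
    have h20 : (2 - omega) ^ 3 = omega * baseY := by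
      rw [baseY]; linear_combination 7 * w2 - w3
    have hY : baseY ≠ 0 := by
      intro h; rw [h] at h20; simp [hz0] at h20
    have hX := baseX_ne_zero
    have : s1 ^ 3 = omega * z ^ 3 / (starRingEnd ℂ) z ^ 3 := by
      rw [hs1, div_pow, mul_pow, mul_pow, mul_pow, hs, h30, h20]
      field_simp
    rw [this]
    field_simp
  have hn : ‖1 - s1 ^ 3‖ = √3 / ‖z‖ ^ 3 := by
    rw [h3, norm_div, norm_mul, norm_pow, norm_omega, one_mul, Complex.norm_conj]
    congr 1
    rw [eq_comm, Real.sqrt_eq_iff_eq_sq (by norm_num) (norm_nonneg _), ← norm_pow, h]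
    norm_num
  obtain ⟨j, hj⟩ := exists_omega_pow_mul_close s1
  refine ⟨omega ^ (2 * j) * z, mul_mem (pow_mem omega_mem _) hz, ?_, ?_⟩
  · rw [norm_mul, norm_pow, norm_omega, one_pow, one_mul]
  · have e : s * ((3 + omega) * (omega ^ (2 * j) * z)) /
        ((2 - omega) * (starRingEnd ℂ) (omega ^ (2 * j) * z)) = omega ^ j * s1 := by
      rw [map_mul, map_pow, hconj, hs1, ← pow_mul]
      have : omega ^ (2 * (2 * j)) = omega ^ j := by
        rw [show 2 * (2 * j) = 3 * j + j by ring, pow_add, pow_mul, w3, one_pow, one_mul]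
      rw [this]
      have : omega ^ (2 * j) = omega ^ j * omega ^ j := by rw [two_mul, pow_add]
      rw [this]
      field_simp
    rw [e]
    refine hj.trans ?_
    rw [hn, ← mul_div_assoc]
    gcongr
    have : √3 ≤ 1.7321 := by
      rw [Real.sqrt_le_left (by norm_num)]; norm_num
    norm_num at this ⊢
    linarith

/-- The linear form in the Padé numerator and denominator attached to `z`. -/
noncomputable def padeLambda (z : ℂ) (n : ℕ) : ℂ :=
  (3 + omega) * z * padeForm n baseX baseY -
    (2 - omega) * (starRingEnd ℂ) z * padeForm n baseY baseX

lemma padeLambda_ne_zero {z : ℂ} (h0 : z ≠ 0) (n : ℕ) :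
    padeLambda z n ≠ 0 ∨ padeLambda z (n + 1) ≠ 0 := by
  by_contra! h
  obtain ⟨h1, h2⟩ := h
  have hd := padeD_eval_ne_zero n baseT_ne_one
  have hX := baseX_ne_zero
  have h30 := three_add_omega_ne_zero
  have e : (3 + omega) * z * (baseX ^ n * baseX ^ (n + 1)) * (padeD n).eval (baseY / baseX) = 0 := by
    rw [padeD, eval_sub, eval_mul, eval_mul]
    rw [padeLambda] at h1 h2
    rw [padeForm_eq_eval_padeA n hX, padeForm_eq_eval_padeB n hX] at h1
    rw [padeForm_eq_eval_padeA (n + 1) hX, padeForm_eq_eval_padeB (n + 1) hX] at h2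
    linear_combination baseX ^ (n + 1) * (padeB (n + 1)).eval (baseY / baseX) * h1 -
      baseX ^ n * (padeB n).eval (baseY / baseX) * h2
  simp [h30, h0, hX, hd] at e

lemma norm_padeLambda_le {z s : ℂ} {φ : ℝ} (h0 : z ≠ 0) (hs : Complex.exp (φ * Complex.I) = s)
    (hs3 : s ^ 3 = baseY / baseX) (hφ : φ ^ 2 ≤ 0.00097835)
    (hc : ‖s * ((3 + omega) * z) / ((2 - omega) * (starRingEnd ℂ) z) - 1‖ ≤ 2.3095 / ‖z‖ ^ 3)
    {N n : ℕ} (hn : n = 4 * N ∨ n = 4 * N + 1) : ‖padeLambda z n‖ ≤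
      0.125 * ‖z‖ * 0.000224 ^ N + 1362 * 2450000000 ^ N / ‖z‖ ^ 2 := by
  have hX := baseX_ne_zero
  have hz := norm_pos_iff.2 h0
  have n3 : ‖(3 + omega : ℂ)‖ ≤ 2.6458 := by
    have := norm_sq_add_mul_omega (3 + omega) 3 1 (by push_cast; ring)
    nlinarith [norm_nonneg (3 + omega : ℂ)]
  have n2 : ‖(2 - omega : ℂ)‖ ≤ 2.6458 := by
    have := norm_sq_add_mul_omega (2 - omega) 2 (-1) (by push_cast; ring)
    nlinarith [norm_nonneg (2 - omega : ℂ)]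
  have hz0 := two_sub_omega_ne_zero
  have hc0 : (starRingEnd ℂ) z ≠ 0 := by simpa using h0
  have hφ1 : |φ| ≤ 0.03129 := by
    rw [← sq_abs] at hφ; nlinarith [abs_nonneg φ]
  have hpow : ∀ a b : ℝ, 0 ≤ a → a ^ 4 ≤ b → a ^ (4 * N) ≤ b ^ N := by
    intro a b ha hab
    rw [pow_mul]
    exact pow_le_pow_left₀ (by positivity) hab N
  have hA : ‖baseX ^ n * (padeP n).eval s‖ ≤ 0.04694 * 0.000224 ^ N := by
    have h1 := norm_padeP_eval_le n φ
    rw [hs] at h1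
    have h2 : ‖baseX ^ n * (padeP n).eval s‖ ≤
        ‖baseX‖ ^ n * (3 / 2 * (27 / 4) ^ n * |φ| ^ (2 * n + 1)) := by
      rw [norm_mul, norm_pow]
      gcongr
      exact h1.trans (by gcongr; exact choose_three_mul_add_one_le n)
    have h3 : ‖baseX‖ ^ n * (3 / 2 * (27 / 4) ^ n * |φ| ^ (2 * n + 1)) =
        3 / 2 * |φ| * (27 / 4 * ‖baseX‖ * φ ^ 2) ^ n := by
      rw [mul_pow, mul_pow, pow_succ, pow_mul, sq_abs]; ring
    have h4 : 27 / 4 * ‖baseX‖ * φ ^ 2 ≤ 0.12231 := by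
      calc 27 / 4 * ‖baseX‖ * φ ^ 2 ≤ 27 / 4 * 18.5203 * 0.00097835 := by
            gcongr; exact norm_baseX_le
        _ ≤ 0.12231 := by norm_num
    have h5 : (27 / 4 * ‖baseX‖ * φ ^ 2) ^ n ≤ 0.000224 ^ N := by
      refine (pow_le_pow_of_le_one (by positivity) (by linarith)
        (by omega : 4 * N ≤ n)).trans (hpow _ _ (by positivity) ?_)
      calc (27 / 4 * ‖baseX‖ * φ ^ 2) ^ 4 ≤ 0.12231 ^ 4 := by gcongr
        _ ≤ 0.000224 := by norm_num
    rw [h3] at h2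
    refine h2.trans ?_
    calc 3 / 2 * |φ| * (27 / 4 * ‖baseX‖ * φ ^ 2) ^ n ≤ 3 / 2 * 0.03129 * 0.000224 ^ N := by
          gcongr
      _ ≤ _ := by gcongr; norm_num
  have hB : ‖padeForm n baseY baseX‖ ≤ 222.25 * 2450000000 ^ N := by
    refine (norm_padeForm_le n norm_baseY rfl).trans ?_
    have h1 : 12 * ‖baseX‖ ≤ 222.25 := by linarith [norm_baseX_le]
    calc (12 * ‖baseX‖) ^ n ≤ 222.25 ^ n := by gcongr
      _ ≤ 222.25 ^ (4 * N + 1) := pow_le_pow_right₀ (by norm_num) (by omega)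
      _ = 222.25 * 222.25 ^ (4 * N) := by rw [pow_succ, mul_comm]
      _ ≤ _ := by gcongr; exact hpow _ _ (by norm_num) (by norm_num)
  set c := s * ((3 + omega) * z) / ((2 - omega) * (starRingEnd ℂ) z) with hcdef
  have hc' : s * ((3 + omega) * z) = c * ((2 - omega) * (starRingEnd ℂ) z) := by
    rw [hcdef]; field_simp
  have key : padeLambda z n = (3 + omega) * z * (baseX ^ n * (padeP n).eval s) +
      (2 - omega) * (starRingEnd ℂ) z * (c - 1) * padeForm n baseY baseX := by
    have hP : (padeP n).eval s =
        (padeA n).eval (baseY / baseX) - s * (padeB n).eval (baseY / baseX) := by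
      rw [padeP, eval_sub, eval_comp, eval_mul, eval_comp, eval_X, eval_pow, eval_X, hs3]
    rw [padeLambda, hP, padeForm_eq_eval_padeA n hX, padeForm_eq_eval_padeB n hX]
    linear_combination baseX ^ n * (padeB n).eval (baseY / baseX) * hc'
  rw [key]
  refine (norm_add_le _ _).trans (add_le_add ?_ ?_)
  · rw [norm_mul, norm_mul]
    calc ‖(3 + omega : ℂ)‖ * ‖z‖ * ‖baseX ^ n * (padeP n).eval s‖
        ≤ 2.6458 * ‖z‖ * (0.04694 * 0.000224 ^ N) := by gcongr
      _ = (2.6458 * 0.04694) * ‖z‖ * 0.000224 ^ N := by ring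
      _ ≤ _ := by gcongr; norm_num
  · rw [norm_mul, norm_mul, norm_mul, Complex.norm_conj]
    calc ‖(2 - omega : ℂ)‖ * ‖z‖ * ‖c - 1‖ * ‖padeForm n baseY baseX‖
        ≤ 2.6458 * ‖z‖ * (2.3095 / ‖z‖ ^ 3) * (222.25 * 2450000000 ^ N) := by gcongr
      _ = (2.6458 * 2.3095 * 222.25) * 2450000000 ^ N / ‖z‖ ^ 2 := by field_simp
      _ ≤ _ := by gcongr; norm_num

lemma pade_inequality {z : ℂ} (hz : z ∈ eisenstein) (h0 : z ≠ 0)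
    (h : (omega * (starRingEnd ℂ) z ^ 3 - omega ^ 2 * z ^ 3) ^ 2 = -3) {N : ℕ} (hN : 1 ≤ N) :
    2 / 5 * (27 / 4) ^ N ≤ 6 * N * (4 * N + 1) *
      (0.125 * ‖z‖ * 0.000224 ^ N + 1362 * 2450000000 ^ N / ‖z‖ ^ 2) := by
  obtain ⟨φ, hs3, hφ⟩ := exists_exp_cube_eq
  obtain ⟨z', hz', hnorm, hc⟩ := exists_close hz h0 h hs3
  have h0' : z' ≠ 0 := by rw [← norm_pos_iff, hnorm]; exact norm_pos_iff.2 h0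
  rw [← hnorm] at hc ⊢
  obtain ⟨r, hr, hmem⟩ := exists_padeForm_mem (show 0 < N by omega)
  have main : ∀ n, n = 4 * N ∨ n = 4 * N + 1 → padeLambda z' n ≠ 0 →
      2 / 5 * (27 / 4 : ℝ) ^ N ≤ 6 * N * (4 * N + 1) * ‖padeLambda z' n‖ := by
    intro n hn hne
    set c : ℂ := (4 * N + 1) * 3 ^ r * ((4 * N).factorial * (3 * N).factorial) /
        ((6 * N).factorial * N.factorial) with hcdef
    have hc0 : c ≠ 0 := by
      have : (4 * N + 1 : ℂ) ≠ 0 := by exact_mod_cast (4 * N).succ_ne_zero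
      have hf := fun m : ℕ => (Nat.cast_ne_zero (R := ℂ)).2 (Nat.factorial_ne_zero m)
      rw [hcdef]
      simp [this, hf]
    have hm : c * padeLambda z' n ∈ eisenstein := by
      have h1 := hmem n hn _ baseX_mem _ baseY_mem baseX_sub_baseY_sq
      have h2 := hmem n hn _ baseY_mem _ baseX_mem
        (by linear_combination baseX_sub_baseY_sq)
      have e : c * padeLambda z' n = (3 + omega) * z' * (c * padeForm n baseX baseY) -
          (2 - omega) * (starRingEnd ℂ) z' * (c * padeForm n baseY baseX) := by
        rw [padeLambda]; ring
      rw [e]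
      have h3 : (3 + omega : ℂ) ∈ eisenstein := ⟨3, 1, by push_cast; ring⟩
      have h4 : (2 - omega : ℂ) ∈ eisenstein := ⟨2, -1, by push_cast; ring⟩
      exact sub_mem (mul_mem (mul_mem h3 hz') h1) (mul_mem (mul_mem h4 (conj_mem hz')) h2)
    have h1 := one_le_norm_of_mem hm (mul_ne_zero hc0 hne)
    have hcn : ‖c‖ = (4 * N + 1) * 3 ^ r * ((4 * N).factorial * (3 * N).factorial) /
        ((6 * N).factorial * N.factorial) := by
      have : c = (((4 * N + 1) * 3 ^ r * ((4 * N).factorial * (3 * N).factorial) /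
        ((6 * N).factorial * N.factorial) : ℝ) : ℂ) := by rw [hcdef]; push_cast; rfl
      rw [this, Complex.norm_real, Real.norm_of_nonneg (by positivity)]
    rw [norm_mul, hcn, div_mul_eq_mul_div, le_div_iff₀ (by positivity), one_mul] at h1
    have hr' : (3 : ℝ) ^ r ≤ 6 * N := by exact_mod_cast hr
    have h2 := content_ratio_ge hN
    have hpos : (0 : ℝ) < (4 * N).factorial * (3 * N).factorial := by positivity
    refine le_of_mul_le_mul_right ?_ hpos
    calc 2 / 5 * (27 / 4 : ℝ) ^ N * ((4 * N).factorial * (3 * N).factorial)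
        ≤ 2 / 5 * (27 / 4) ^ N * (1 + 1 / (N + 1)) * ((4 * N).factorial * (3 * N).factorial) := by
          have : (0 : ℝ) ≤ 1 / (N + 1) := by positivity
          exact mul_le_mul_of_nonneg_right
            (le_mul_of_one_le_right (by positivity) (by linarith)) hpos.le
      _ ≤ _ := h2
      _ ≤ _ := h1
      _ ≤ (4 * N + 1) * (6 * N) * ((4 * N).factorial * (3 * N).factorial) *
          ‖padeLambda z' n‖ := by gcongr
      _ = _ := by ring
  have fin : ∀ n, n = 4 * N ∨ n = 4 * N + 1 → padeLambda z' n ≠ 0 → 2 / 5 * (27 / 4 : ℝ) ^ N ≤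
      6 * N * (4 * N + 1) *
      (0.125 * ‖z'‖ * 0.000224 ^ N + 1362 * 2450000000 ^ N / ‖z'‖ ^ 2) := fun n hn hne =>
    (main n hn hne).trans (by gcongr; exact norm_padeLambda_le h0' rfl hs3 hφ hc hn)
  rcases padeLambda_ne_zero h0' (4 * N) with h | h
  · exact fin _ (Or.inl rfl) h
  · exact fin _ (Or.inr rfl) h

lemma pade_inequality_fails {N : ℕ} (hN : 81 ≤ N) : 6 * N * (4 * N + 1) *
    (0.125 * 5.6 ^ N + 851250000000 * 3.92 ^ N) < (2 / 5 * (27 / 4) ^ N : ℝ) := by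
  induction N, hN using Nat.le_induction with
  | base => norm_num
  | succ N hN ih =>
    have hN' : (81 : ℝ) ≤ N := by exact_mod_cast hN
    have h1 : (6 * (N + 1) * (4 * (N + 1) + 1) : ℝ) ≤ 1.03 * (6 * N * (4 * N + 1)) := by nlinarith
    have h2 : (0.125 * 5.6 ^ (N + 1) + 851250000000 * 3.92 ^ (N + 1) : ℝ) ≤
        5.6 * (0.125 * 5.6 ^ N + 851250000000 * 3.92 ^ N) := by
      have : (0 : ℝ) < 3.92 ^ N := by positivity
      rw [pow_succ, pow_succ]; linarith
    have h3 := mul_le_mul h1 h2 (by positivity) (by positivity)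
    have h4 : (0 : ℝ) < 2 / 5 * (27 / 4) ^ N := by positivity
    push_cast
    rw [pow_succ (27 / 4 : ℝ)]
    linarith

lemma norm_lt_of_sq_eq {z : ℂ} (hz : z ∈ eisenstein) (h0 : z ≠ 0)
    (h : (omega * (starRingEnd ℂ) z ^ 3 - omega ^ 2 * z ^ 3) ^ 2 = -3) : ‖z‖ < 25000 ^ 80 := by
  by_contra! hlt
  obtain ⟨n, h1, h2⟩ := exists_nat_pow_near (x := ‖z‖) (y := 25000)
    (le_trans (one_le_pow₀ (by norm_num)) hlt) (by norm_num)
  have hn : 80 < n + 1 := by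
    by_contra! hle
    exact absurd (hlt.trans_lt h2)
      (not_lt.2 (pow_le_pow_right₀ (by norm_num) hle))
  have hin := pade_inequality hz h0 h (N := n + 1) (by omega)
  refine absurd (pade_inequality_fails (N := n + 1) (by omega)) (not_lt.2 (hin.trans ?_))
  have e1 : 0.125 * ‖z‖ * 0.000224 ^ (n + 1) ≤ 0.125 * 5.6 ^ (n + 1) := by
    calc 0.125 * ‖z‖ * 0.000224 ^ (n + 1) ≤ 0.125 * 25000 ^ (n + 1) * 0.000224 ^ (n + 1) := by
          gcongr
      _ = 0.125 * 5.6 ^ (n + 1) := by rw [mul_assoc, ← mul_pow]; norm_num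
  have e2 : 1362 * 2450000000 ^ (n + 1) / ‖z‖ ^ 2 ≤ 851250000000 * 3.92 ^ (n + 1) := by
    calc 1362 * 2450000000 ^ (n + 1) / ‖z‖ ^ 2
        ≤ 1362 * 2450000000 ^ (n + 1) / (25000 ^ n) ^ 2 := by gcongr
      _ = 851250000000 * 3.92 ^ (n + 1) := by
        rw [div_eq_iff (by positivity), ← pow_mul, mul_comm n 2, pow_mul,
          show (3.92 : ℝ) = 2450000000 / 25000 ^ 2 by norm_num, div_pow, pow_succ (25000 ^ 2 : ℝ)]
        field_simp
        norm_num
  gcongr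

/-- An integral solution of `a³ - 3ab² - b³ = ±1` is bounded. -/
lemma sq_add_mul_add_sq_lt {a b : ℤ}
    (h : (a ^ 3 - 3 * a * b ^ 2 - b ^ 3) ^ 2 = 1) : a ^ 2 + a * b + b ^ 2 < 25000 ^ 160 := by
  set z : ℂ := a - b * omega with hz
  have hmem : z ∈ eisenstein := ⟨a, -b, by push_cast; ring⟩
  have hsq : ‖z‖ ^ 2 = a ^ 2 + a * b + b ^ 2 := by
    rw [norm_sq_add_mul_omega z a (-b) (by push_cast; ring)]; ring
  have h0 : z ≠ 0 := by
    intro h0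
    have e : (a ^ 2 + a * b + b ^ 2 : ℝ) = 0 := by rw [← hsq, h0]; simp
    have e : a ^ 2 + a * b + b ^ 2 = 0 := by exact_mod_cast e
    have hb : b = 0 := by nlinarith [sq_nonneg (2 * a + b), sq_nonneg b]
    have ha : a = 0 := by nlinarith [sq_nonneg (2 * b + a), sq_nonneg a]
    rw [ha, hb] at h; norm_num at h
  have hlt := norm_lt_of_sq_eq hmem h0 (by
    have h' : ((a : ℂ) ^ 3 - 3 * a * b ^ 2 - b ^ 3) ^ 2 = 1 := by exact_mod_cast h
    have e : omega * (starRingEnd ℂ) z ^ 3 - omega ^ 2 * z ^ 3 =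
        (2 * omega + 1) * ((a : ℂ) ^ 3 - 3 * a * b ^ 2 - b ^ 3) := by
      rw [hz, map_sub, map_mul, conj_omega, map_intCast, map_intCast, ← omega_sq]
      linear_combination (3 * a * b ^ 2 * (omega ^ 2 - omega) -
        b ^ 3 * (omega * (omega ^ 3 + 1) - omega ^ 2)) * omega_pow_three -
        ((a : ℂ) ^ 3 - 3 * a * b ^ 2 - b ^ 3) * omega_sq
    rw [e, mul_pow, h']
    linear_combination 4 * omega_sq)
  have : (a ^ 2 + a * b + b ^ 2 : ℝ) < 25000 ^ 160 := by
    rw [← hsq, show (25000 : ℝ) ^ 160 = (25000 ^ 80) ^ 2 by rw [← pow_mul]]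
    gcongr
  exact_mod_cast this

/-- Follows the continued fraction expansion with the given partial quotients of the root of the
binary cubic form with coefficients `A, B, C, D`, checking that the form takes the values `±1` at
no points away from the root except those of size at most `3`. The current basis vectors have
sizes `p` and `q`, and the process has to reach size `M`. -/
def cubicCheck (M : ℕ) : List ℕ → ℤ → ℤ → ℤ → ℤ → ℕ → ℕ → Bool
  | [], _, _, _, _, p, q => decide (M ≤ p + q)
  | t :: ts, A, B, C, D, p, q =>
    decide ((0 ≤ A * t ^ 3 + B * t ^ 2 + C * t + D ∧ 0 ≤ B * t ^ 2 + 2 * C * t + 3 * D ∧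
        0 ≤ C * t + 3 * D ∧ 0 ≤ D ∧
        (t : ℤ) ^ 3 < A * t ^ 3 + 2 * B * t ^ 2 + 4 * C * t + 8 * D) ∨
      (A * t ^ 3 + B * t ^ 2 + C * t + D ≤ 0 ∧ B * t ^ 2 + 2 * C * t + 3 * D ≤ 0 ∧
        C * t + 3 * D ≤ 0 ∧ D ≤ 0 ∧
        A * t ^ 3 + 2 * B * t ^ 2 + 4 * C * t + 8 * D < -(t : ℤ) ^ 3)) &&
    (decide (t * p + q ≤ 3 ∨ ((A * t ^ 3 + B * t ^ 2 + C * t + D ≠ 1) ∧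
      (A * t ^ 3 + B * t ^ 2 + C * t + D ≠ -1))) &&
    cubicCheck M ts (A * t ^ 3 + B * t ^ 2 + C * t + D) (3 * A * t ^ 2 + 2 * B * t + C)
      (3 * A * t + B) A (t * p + q) p)

lemma sum_le_cubic {a b c d x y : ℤ} (ha : 0 ≤ a) (hb : 0 ≤ b) (hc : 0 ≤ c) (hd : 0 ≤ d)
    (hx : 1 ≤ x) (hy : 1 ≤ y) :
    a + b + c + d ≤ a * x ^ 3 + b * (x ^ 2 * y) + c * (x * y ^ 2) + d * y ^ 3 := by
  have h1 : 1 ≤ x ^ 3 := one_le_pow₀ hx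
  have h2 : 1 ≤ x ^ 2 * y := one_le_mul_of_one_le_of_one_le (one_le_pow₀ hx) hy
  have h3 : 1 ≤ x * y ^ 2 := one_le_mul_of_one_le_of_one_le hx (one_le_pow₀ hy)
  have h4 : 1 ≤ y ^ 3 := one_le_pow₀ hy
  linarith [le_mul_of_one_le_right ha h1, le_mul_of_one_le_right hb h2,
    le_mul_of_one_le_right hc h3, le_mul_of_one_le_right hd h4]

lemma le_three_of_cubicCheck {M : ℕ} {l : List ℕ} : ∀ {A B C D : ℤ} {p q : ℕ},
    cubicCheck M l A B C D p q = true → ∀ m n : ℕ, 1 ≤ m → 1 ≤ n →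
    (A * m ^ 3 + B * m ^ 2 * n + C * m * n ^ 2 + D * n ^ 3) ^ 2 = 1 → m * p + n * q < M →
    m * p + n * q ≤ 3 := by
  induction l with
  | nil =>
    intro A B C D p q h m n hm hn _ hlt
    have : M ≤ p + q := by simpa [cubicCheck] using h
    nlinarith
  | cons t ts ih =>
    intro A B C D p q h m n hm hn hF hlt
    rw [cubicCheck, Bool.and_eq_true, Bool.and_eq_true, decide_eq_true_iff,
      decide_eq_true_iff] at h
    obtain ⟨hside, hunit, hrec⟩ := h
    rcases le_or_gt (t * n) m with hmn | hmn
    · obtain ⟨r, rfl⟩ := Nat.exists_eq_add_of_le hmn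
      have hsize : (t * n + r) * p + n * q = n * (t * p + q) + r * p := by ring
      rw [hsize] at hlt ⊢
      have hF' : ((A * t ^ 3 + B * t ^ 2 + C * t + D) * n ^ 3 +
          (3 * A * t ^ 2 + 2 * B * t + C) * n ^ 2 * r + (3 * A * t + B) * n * r ^ 2 +
          A * r ^ 3) ^ 2 = 1 := by
        rw [← hF]; push_cast; ring
      rcases Nat.eq_zero_or_pos r with rfl | hr
      · have hF2 : ((A * t ^ 3 + B * t ^ 2 + C * t + D) * (n : ℤ) ^ 3) ^ 2 = 1 := by
          rw [← hF']; push_cast; ring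
        have hn1 : n = 1 := by
          have : (n : ℤ) ∣ 1 := ⟨(A * t ^ 3 + B * t ^ 2 + C * t + D) ^ 2 * n ^ 5, by
            rw [← hF2]; ring⟩
          exact Nat.dvd_one.1 (by exact_mod_cast this)
        rw [hn1, Nat.cast_one, one_pow, mul_one] at hF2
        have := hunit.resolve_right fun h => (sq_ne_one_iff.2 h) hF2
        rw [hn1]; linarith
      · exact ih hrec n r hn hr hF' hlt
    · exfalso
      obtain ⟨N, hN⟩ : ∃ N : ℤ, N = t * n - m := ⟨_, rfl⟩
      have hN1 : 1 ≤ N := by rw [hN]; have : (m : ℤ) < t * n := by exact_mod_cast hmn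
                             linarith
      have hm1 : (1 : ℤ) ≤ m := by exact_mod_cast hm
      have key : (t : ℤ) ^ 3 * (A * m ^ 3 + B * m ^ 2 * n + C * m * n ^ 2 + D * n ^ 3) =
          (A * t ^ 3 + B * t ^ 2 + C * t + D) * m ^ 3 +
          (B * t ^ 2 + 2 * C * t + 3 * D) * (m ^ 2 * N) + (C * t + 3 * D) * (m * N ^ 2) +
          D * N ^ 3 := by rw [hN]; ring
      have ht : (0 : ℤ) ≤ (t : ℤ) ^ 3 := by positivity
      rcases sq_eq_one_iff.1 hF with h1 | h1
      all_goals
        rw [h1] at key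
        rcases hside with ⟨h2, h3, h4, h5, h6⟩ | ⟨h2, h3, h4, h5, h6⟩
        · have := sum_le_cubic h2 h3 h4 h5 hm1 hN1
          linarith
        · have := sum_le_cubic (neg_nonneg.2 h2) (neg_nonneg.2 h3) (neg_nonneg.2 h4)
            (neg_nonneg.2 h5) hm1 hN1
          linarith

/-- The first partial quotients of the positive root of `x³ - 3x - 1`. -/
def rootQuotients : List ℕ :=
  [1, 1, 7, 3, 2, 3, 1, 1, 6, 11, 1, 3, 2, 1, 9, 36, 1, 1, 55, 81, 2, 1, 7, 11, 5, 2, 3, 4, 2,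
   1, 1, 6, 1, 60, 13, 4, 1, 1, 1, 4, 1, 1, 2, 6, 4, 4, 1, 17, 1, 8, 1, 4, 6, 2, 5, 1, 6, 4, 4,
   1, 12, 3, 2, 5, 2, 1, 1, 1, 1, 4, 1, 2, 13, 1, 1, 13, 1, 1, 2, 1, 3, 3, 3, 2, 1, 10, 10, 20,
   3, 2, 1, 232, 1, 1, 1, 2, 1, 4, 4, 1, 1, 1, 1, 2, 5, 1, 1, 6, 59, 4, 2, 1, 10, 1, 9, 1, 1, 1,
   10, 1, 1, 4, 1, 10, 1, 1, 2, 1, 1, 3, 3, 2, 1, 19, 1, 2, 2, 9, 2, 26, 25, 1, 3, 2, 9, 3, 37,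
   3, 3, 1, 30, 1, 1, 1, 1, 21, 2, 4130, 2, 2, 2, 2, 1, 8, 5, 1, 3, 1, 1, 1, 1, 2, 1, 2, 1, 14,
   4, 1, 1, 1, 3, 1, 1, 1, 1, 3, 1, 8, 3, 2, 3, 1, 4, 5, 1, 2, 2, 2, 2, 1, 4, 1, 4, 1, 3, 2, 38,
   1, 3, 2, 5, 12, 2, 3, 1, 48, 2, 4, 3, 2, 4, 2, 2, 2, 27, 66, 4, 1, 348, 3, 1, 1, 3, 1, 2, 1,
   2, 1, 130, 2, 4, 2, 1, 1, 2, 1, 2, 1, 2, 1, 1, 1, 3, 1, 1, 3, 6, 2, 4, 3, 1, 13, 1, 12, 1,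
   39, 1, 6, 1, 3, 5, 2, 1, 7, 1, 1, 12, 1, 2, 2, 1, 4, 6, 2, 2, 1, 110, 1, 4, 12, 1, 2, 17, 1,
   3, 4, 1, 1, 13, 7, 2, 4, 2, 1, 1, 9, 13, 21, 3, 41, 1, 1, 6, 1, 1, 16, 1, 1159, 2, 4, 1, 12,
   4, 18, 1, 2, 6, 1, 1, 2, 2, 3, 1, 1, 5, 1, 2, 1, 2, 1, 2, 1, 1, 1, 3, 1, 194, 41, 1, 13, 1,
   1, 11, 37, 1, 2, 4, 3, 1, 4, 2, 13, 7, 3, 2, 1, 3, 11, 2, 1, 6, 1, 35, 7, 3, 3, 20, 3, 3, 2,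
   4, 9, 1, 2, 1, 1, 3, 5, 5, 3, 7, 35, 1, 6, 1, 2, 1, 1, 3, 7, 2, 1, 1, 1, 3, 1, 2, 3, 1, 9, 1,
   1, 2, 5, 8, 12, 3, 2, 14, 25, 2, 23, 3, 3, 2, 2, 2, 5, 5, 1, 2, 1, 2, 5, 2, 2, 6, 5, 11, 1,
   2, 1, 11, 8, 1, 1, 1, 4, 1, 4, 1, 2, 1, 2, 1, 6, 2, 1, 16, 260, 3, 1, 1, 1, 3, 1, 34, 1, 4,
   2, 2, 5, 5, 9, 14, 12, 3, 1, 1, 1, 21, 1, 3, 2, 6, 1, 5, 1, 2, 10, 1, 1, 15, 1, 1, 12, 1, 4,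
   6, 1, 2, 356, 2, 1, 13, 13, 3, 5, 12, 4, 2, 2, 8, 1, 2, 1, 3, 3, 7, 1, 6, 1, 5, 1, 1, 1, 5,
   1, 2, 5, 1, 3, 2, 9, 1, 50, 1, 14, 1, 1, 2, 3, 8, 4, 1, 1, 6, 130, 2, 5, 1, 1, 1, 260, 1, 1,
   2, 1, 4, 1, 1, 4, 1, 1, 73, 1, 4, 39, 3, 3, 2, 4, 2, 1, 3, 128, 2, 2, 3, 1, 2, 8, 5, 23, 1,
   1, 9, 2, 1, 22, 2, 18, 1, 3, 4, 1, 13, 2, 3, 1, 309, 1, 6, 1, 1, 1, 5, 1, 20, 1, 2, 1, 23, 1,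
   28, 1, 8, 1, 1, 1, 5, 2, 41, 2, 2, 1, 28, 1, 111, 1, 6, 1, 14, 1, 11, 3, 1, 2, 1, 1, 2, 1, 2,
   1, 2, 2, 6, 2, 3, 2, 1, 3, 3, 10, 1, 87]

lemma cubicCheck_rootQuotients :
    cubicCheck (10 ^ 353) rootQuotients 1 0 (-3) (-1) 1 1 = true := by
  decide +kernel

set_option exponentiation.threshold 1000 in
lemma sq_add_mul_add_sq_le_of_nat {m n : ℕ}
    (h : ((m : ℤ) ^ 3 - 3 * m * n ^ 2 - n ^ 3) ^ 2 = 1) :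
    (m : ℤ) ^ 2 + m * n + n ^ 2 ≤ 7 := by
  have hs : m + n ≤ 3 := by
    rcases Nat.eq_zero_or_pos m with rfl | hm
    · have : (n : ℤ) ∣ 1 := ⟨n ^ 5, by rw [← h]; push_cast; ring⟩
      have := Nat.dvd_one.1 (by exact_mod_cast this)
      omega
    rcases Nat.eq_zero_or_pos n with rfl | hn
    · have : (m : ℤ) ∣ 1 := ⟨m ^ 5, by rw [← h]; push_cast; ring⟩
      have := Nat.dvd_one.1 (by exact_mod_cast this)
      omega
    have hlt := sq_add_mul_add_sq_lt h
    have hlt' : m * 1 + n * 1 < 10 ^ 353 := by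
      rw [mul_one, mul_one]
      have h1 : ((m : ℤ) + n) ^ 2 < (10 ^ 353) ^ 2 := by
        refine lt_of_le_of_lt (b := 2 * (m ^ 2 + m * n + n ^ 2 : ℤ)) ?_ ?_
        · nlinarith [sq_nonneg (m : ℤ), sq_nonneg (n : ℤ)]
        · refine (mul_lt_mul_of_pos_left hlt (by norm_num)).trans_le ?_
          norm_num
      exact_mod_cast lt_of_pow_lt_pow_left₀ 2 (by positivity) h1
    have := le_three_of_cubicCheck cubicCheck_rootQuotients m n hm hn
      (by refine Eq.trans ?_ h; ring) hlt'
    omega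
  have hm : m ≤ 3 := by omega
  have hn : n ≤ 3 := by omega
  interval_cases m <;> interval_cases n <;> omega

/-- The integral solutions of `a³ - 3ab² - b³ = ±1` are small. -/
lemma sq_add_mul_add_sq_le {a b : ℤ} (h : (a ^ 3 - 3 * a * b ^ 2 - b ^ 3) ^ 2 = 1) :
    a ^ 2 + a * b + b ^ 2 ≤ 7 := by
  have pos : ∀ a b : ℤ, (a ^ 3 - 3 * a * b ^ 2 - b ^ 3) ^ 2 = 1 → 0 ≤ a → 0 ≤ b →
      a ^ 2 + a * b + b ^ 2 ≤ 7 := by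
    intro a b h ha hb
    lift a to ℕ using ha
    lift b to ℕ using hb
    exact sq_add_mul_add_sq_le_of_nat h
  have same : ∀ a b : ℤ, (a ^ 3 - 3 * a * b ^ 2 - b ^ 3) ^ 2 = 1 →
      (0 ≤ a ∧ 0 ≤ b ∨ a ≤ 0 ∧ b ≤ 0) → a ^ 2 + a * b + b ^ 2 ≤ 7 := by
    rintro a b h (⟨ha, hb⟩ | ⟨ha, hb⟩)
    · exact pos a b h ha hb
    · have := pos (-a) (-b) (by rw [← h]; ring) (by linarith) (by linarith)
      linarith
  by_cases h1 : 0 ≤ a ∧ 0 ≤ b ∨ a ≤ 0 ∧ b ≤ 0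
  · exact same a b h h1
  by_cases h2 : 0 ≤ b ∧ 0 ≤ -a - b ∨ b ≤ 0 ∧ -a - b ≤ 0
  · have := same b (-a - b) (by rw [← h]; ring) h2
    linarith
  · have := same (-a - b) a (by rw [← h]; ring) (by omega)
    linarith

/-- The homogenization of the numerator of `f`. -/
def numForm (a b : ℤ) : ℤ :=
  3 ^ 7 * (a ^ 2 - b ^ 2) ^ 3 *
    (a ^ 6 + 3 * a ^ 5 * b + 6 * a ^ 4 * b ^ 2 + a ^ 3 * b ^ 3 - 3 * a ^ 2 * b ^ 4 +
      12 * a * b ^ 5 + 16 * b ^ 6) ^ 3 *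
    (2 * a ^ 3 + 3 * a ^ 2 * b - 3 * a * b ^ 2 - 5 * b ^ 3)

lemma eq_three_of_prime_dvd {a b : ℤ} (hab : IsCoprime a b) {p : ℕ} (hp : p.Prime)
    (h1 : (p : ℤ) ∣ a ^ 3 - 3 * a * b ^ 2 - b ^ 3) (h2 : (p : ℤ) ∣ numForm a b) : p = 3 := by
  by_contra hne
  have hp' : Prime (p : ℤ) := Nat.prime_iff_prime_int.1 hp
  have h3 : ¬ (p : ℤ) ∣ 3 := by
    intro h
    have : p ∣ 3 := by exact_mod_cast h
    exact hne ((Nat.prime_dvd_prime_iff_eq hp Nat.prime_three).1 this)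
  have hb : ¬ (p : ℤ) ∣ b := by
    intro h
    have h4 : (p : ℤ) ∣ a ^ 3 := by
      have e : a ^ 3 = (a ^ 3 - 3 * a * b ^ 2 - b ^ 3) + b * (3 * a * b + b ^ 2) := by ring
      rw [e]; exact dvd_add h1 (h.mul_right _)
    exact hp'.not_isUnit (hab.isUnit_of_dvd' (hp'.dvd_of_dvd_pow h4) h)
  have reduce : ∀ {c u v : ℤ}, (p : ℤ) ∣ c →
      v = u * (a ^ 3 - 3 * a * b ^ 2 - b ^ 3) + c → (p : ℤ) ∣ v := by
    rintro c u v hc rfl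
    exact dvd_add (h1.mul_left _) hc
  have hsub : ¬ (p : ℤ) ∣ a - b := by
    intro h
    have : (p : ℤ) ∣ 3 * b ^ 3 :=
      reduce (u := -1) (h.mul_right (a ^ 2 + a * b - 2 * b ^ 2)) (by ring)
    exact (hp'.dvd_or_dvd this).elim h3 fun h => hb (hp'.dvd_of_dvd_pow h)
  have hadd : ¬ (p : ℤ) ∣ a + b := by
    intro h
    have : (p : ℤ) ∣ b ^ 3 :=
      reduce (u := 1) (h.mul_right (-a ^ 2 + a * b + 2 * b ^ 2)) (by ring)
    exact hb (hp'.dvd_of_dvd_pow this)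
  have hquad : ¬ (p : ℤ) ∣ a ^ 2 + a * b - b ^ 2 := by
    intro h
    have h5 : (p : ℤ) ∣ b ^ 2 * (a + 2 * b) :=
      reduce (u := -1) (h.mul_right (a - b)) (by ring)
    have h6 := (hp'.dvd_or_dvd h5).resolve_left fun h => hb (hp'.dvd_of_dvd_pow h)
    have h7 : (p : ℤ) ∣ b ^ 2 := by
      have e : b ^ 2 = (a ^ 2 + a * b - b ^ 2) - (a + 2 * b) * (a - b) := by ring
      rw [e]; exact dvd_sub h (h6.mul_right _)
    exact hb (hp'.dvd_of_dvd_pow h7)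
  rw [numForm] at h2
  rcases hp'.dvd_or_dvd h2 with h2 | h2
  · rcases hp'.dvd_or_dvd h2 with h2 | h2
    · rcases hp'.dvd_or_dvd h2 with h2 | h2
      · exact h3 (hp'.dvd_of_dvd_pow h2)
      · have h2 := hp'.dvd_of_dvd_pow h2
        rw [sq_sub_sq] at h2
        exact (hp'.dvd_or_dvd h2).elim hadd hsub
    · have h2 := hp'.dvd_of_dvd_pow h2
      have : (p : ℤ) ∣ 3 ^ 3 * ((a + b) ^ 2 * b ^ 4) :=
        reduce (u := -(a ^ 3 + 3 * a ^ 2 * b + 9 * a * b ^ 2 + 11 * b ^ 3)) h2 (by ring)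
      rcases hp'.dvd_or_dvd this with h | h
      · exact h3 (hp'.dvd_of_dvd_pow h)
      · exact (hp'.dvd_or_dvd h).elim (fun h => hadd (hp'.dvd_of_dvd_pow h))
          fun h => hb (hp'.dvd_of_dvd_pow h)
  · have : (p : ℤ) ∣ 3 * ((a ^ 2 + a * b - b ^ 2) * b) := reduce (u := -2) h2 (by ring)
    rcases hp'.dvd_or_dvd this with h | h
    · exact h3 h
    · exact (hp'.dvd_or_dvd h).elim hquad hb

lemma not_nine_dvd {a b : ℤ} (hab : IsCoprime a b) :
    ¬ (9 : ℤ) ∣ a ^ 3 - 3 * a * b ^ 2 - b ^ 3 := by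
  intro h
  have h3 : (3 : ℤ) ∣ a - b := by
    have e : (3 : ℤ) ∣ (a - b) ^ 3 := by
      have : (a - b) ^ 3 = (a ^ 3 - 3 * a * b ^ 2 - b ^ 3) +
          3 * (-a ^ 2 * b + 2 * a * b ^ 2) := by ring
      rw [this]
      exact dvd_add ((by norm_num : (3 : ℤ) ∣ 9).trans h) (Dvd.intro _ rfl)
    exact Int.prime_three.dvd_of_dvd_pow e
  obtain ⟨c, hc⟩ := h3
  obtain rfl : a = b + 3 * c := by linarith
  have hb : (3 : ℤ) ∣ b := by
    have : (9 : ℤ) ∣ 9 * (3 * b * c ^ 2 + 3 * c ^ 3) -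
        ((b + 3 * c) ^ 3 - 3 * (b + 3 * c) * b ^ 2 - b ^ 3) :=
      dvd_sub (Dvd.intro _ rfl) h
    have e : (3 : ℤ) ∣ b ^ 3 := by
      obtain ⟨d, hd⟩ := this
      exact ⟨d, by linarith⟩
    exact Int.prime_three.dvd_of_dvd_pow e
  exact Int.prime_three.not_isUnit (hab.isUnit_of_dvd' (dvd_add hb (Dvd.intro _ rfl)) hb)

lemma sq_eq_one_or_nine {a b k : ℤ} (hab : IsCoprime a b)
    (h0 : a ^ 3 - 3 * a * b ^ 2 - b ^ 3 ≠ 0)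
    (h : k * (a ^ 3 - 3 * a * b ^ 2 - b ^ 3) ^ 9 = numForm a b) :
    (a ^ 3 - 3 * a * b ^ 2 - b ^ 3) ^ 2 = 1 ∨ (a ^ 3 - 3 * a * b ^ 2 - b ^ 3) ^ 2 = 9 := by
  have h9 := not_nine_dvd hab
  have hdvd : a ^ 3 - 3 * a * b ^ 2 - b ^ 3 ∣ numForm a b := by
    rw [← h]; exact (dvd_pow_self _ (by norm_num)).mul_left _
  have hpow := Nat.eq_prime_pow_of_unique_prime_dvd (p := 3) (Int.natAbs_ne_zero.2 h0)
    fun {d} hd hdd => eq_three_of_prime_dvd hab hd (Int.natCast_dvd.2 hdd)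
      ((Int.natCast_dvd.2 hdd).trans hdvd)
  generalize (a ^ 3 - 3 * a * b ^ 2 - b ^ 3).natAbs.primeFactorsList.length = e at hpow
  have he : e ≤ 1 := by
    by_contra! he
    refine h9 (Int.natCast_dvd (m := 9).2 ?_)
    rw [hpow]
    exact pow_dvd_pow 3 he
  rw [← Int.natAbs_sq, hpow]
  interval_cases e <;> norm_num

lemma sq_add_mul_add_sq_eq_three {a b : ℤ} (h : (a ^ 3 - 3 * a * b ^ 2 - b ^ 3) ^ 2 = 9) :
    a ^ 2 + a * b + b ^ 2 = 3 := by
  set g := a ^ 3 + 6 * a ^ 2 * b + 3 * a * b ^ 2 - b ^ 3 with hg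
  set q := a ^ 2 + a * b + b ^ 2 with hq
  have h1 : g ^ 2 + 27 = 4 * q ^ 3 := by rw [hg, hq]; linear_combination -3 * h
  have hq0 : q ≠ 0 := by intro h0; rw [h0] at h1; nlinarith [sq_nonneg g]
  have hg2 : g ^ 2 = 81 := by
    by_contra hne
    refine fermatLastTheoremFor_iff_int.1 fermatLastTheoremThree (9 + g) (9 - g) (6 * q) ?_ ?_
      (by simpa using hq0) (by linear_combination 54 * h1)
    · intro h; apply hne; rw [show g = -9 by linarith]; norm_num
    · intro h; apply hne; rw [show g = 9 by linarith]; norm_num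
  have hq3 : q ^ 3 = 3 ^ 3 := by linarith
  exact (Odd.strictMono_pow (by decide : Odd 3)).injective hq3

lemma eq_of_f_eq {x : ℚ} {k : ℤ} (hk : k ≠ 0) (h : f x = k) :
    x = 0 ∨ x = -1 ∨ x = 2 ∨ x = -1 / 3 ∨ x = -3 / 2 ∨ x = 1 ∨ x = -2 ∨ x = -1 / 2 := by
  have hx : x = x.num / x.den := (Rat.num_div_den x).symm
  have hab : IsCoprime x.num x.den := Rat.isCoprime_num_den x
  have hb : 0 < x.den := x.den_pos
  generalize x.num = a at *
  generalize x.den = b at *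
  have hbQ : (b : ℚ) ≠ 0 := by exact_mod_cast hb.ne'
  have hD : x ^ 3 - 3 * x - 1 ≠ 0 := by
    intro h0
    rw [f, h0] at h
    apply hk
    exact_mod_cast (by simpa using h.symm : (k : ℚ) = 0)
  have hF : ((a ^ 3 - 3 * a * (b : ℤ) ^ 2 - (b : ℤ) ^ 3 : ℤ) : ℚ) =
      b ^ 3 * (x ^ 3 - 3 * x - 1) := by
    rw [hx]; push_cast; field_simp
  have hF0 : a ^ 3 - 3 * a * (b : ℤ) ^ 2 - (b : ℤ) ^ 3 ≠ 0 := by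
    intro h0
    rw [h0] at hF
    simp [hbQ, hD] at hF
  have hkF : k * (a ^ 3 - 3 * a * (b : ℤ) ^ 2 - (b : ℤ) ^ 3) ^ 9 = numForm a b := by
    have : (k : ℚ) * ((a ^ 3 - 3 * a * (b : ℤ) ^ 2 - (b : ℤ) ^ 3 : ℤ) : ℚ) ^ 9 =
        (numForm a b : ℤ) := by
      have hN : ((numForm a b : ℤ) : ℚ) = b ^ 27 * (3 ^ 7 * (x ^ 2 - 1) ^ 3 *
          (x ^ 6 + 3 * x ^ 5 + 6 * x ^ 4 + x ^ 3 - 3 * x ^ 2 + 12 * x + 16) ^ 3 *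
          (2 * x ^ 3 + 3 * x ^ 2 - 3 * x - 5)) := by
        have ha : (a : ℚ) = b * x := by rw [hx]; field_simp
        rw [numForm]; push_cast; rw [ha]; ring
      rw [hF, ← h, f, hN, mul_pow, ← pow_mul]
      generalize x ^ 3 - 3 * x - 1 = d at hD
      field_simp
    exact_mod_cast this
  have hle : a ^ 2 + a * b + (b : ℤ) ^ 2 ≤ 7 := by
    rcases sq_eq_one_or_nine hab hF0 hkF with h1 | h1
    · exact sq_add_mul_add_sq_le h1
    · rw [sq_add_mul_add_sq_eq_three h1]; norm_num
  have h19 := sq_eq_one_or_nine hab hF0 hkF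
  have hb3 : b ≤ 3 := by
    by_contra! hb4
    have : (4 : ℤ) ≤ b := by exact_mod_cast hb4
    nlinarith [sq_nonneg (2 * a + b)]
  have ha3 : a ≤ 3 := by nlinarith [sq_nonneg (2 * b + a)]
  have ha3' : -3 ≤ a := by nlinarith [sq_nonneg (2 * b + a)]
  clear hkF hF hF0 hle hab
  rw [hx]
  interval_cases b <;> interval_cases a <;>
    first | (norm_num at h19; done) | norm_num

end

/-- The nonzero integers in the image of f on ℚ are exactly 419904, -44789760,
15786448344, 24992518538304, -92515041526500, -70043919611288518656, attained
respectively at x = -2, 0, -1/2, 2, -3/2, -1/3; the value 0 is attained at x = ±1, and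
the remaining integral value 4374 of the paper's table is not attained at any rational x
(it corresponds only to the point x = ∞ of ℙ¹(ℚ)). -/
theorem f_nonzero_integral_values :
    (∀ k : ℤ, k ≠ 0 → ((∃ x : ℚ, f x = (k : ℚ)) ↔
      k = 419904 ∨ k = -44789760 ∨ k = 15786448344 ∨ k = 24992518538304 ∨
      k = -92515041526500 ∨ k = -70043919611288518656)) ∧
    f (-2) = 419904 ∧ f 0 = -44789760 ∧ f (-1/2) = 15786448344 ∧
    f 2 = 24992518538304 ∧ f (-3/2) = -92515041526500 ∧
    f (-1/3) = -70043919611288518656 ∧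
    f 1 = 0 ∧ f (-1) = 0 ∧
    ∀ x : ℚ, f x ≠ 4374 := by
  have v1 : f (-2) = 419904 := by norm_num [f]
  have v2 : f 0 = -44789760 := by norm_num [f]
  have v3 : f (-1 / 2) = 15786448344 := by norm_num [f]
  have v4 : f 2 = 24992518538304 := by norm_num [f]
  have v5 : f (-3 / 2) = -92515041526500 := by norm_num [f]
  have v6 : f (-1 / 3) = -70043919611288518656 := by norm_num [f]
  have v7 : f 1 = 0 := by norm_num [f]
  have v8 : f (-1) = 0 := by norm_num [f]
  have main : ∀ k : ℤ, k ≠ 0 → ((∃ x : ℚ, f x = (k : ℚ)) ↔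
      k = 419904 ∨ k = -44789760 ∨ k = 15786448344 ∨ k = 24992518538304 ∨
      k = -92515041526500 ∨ k = -70043919611288518656) := by
    intro k hk
    constructor
    · rintro ⟨x, hx⟩
      rcases eq_of_f_eq hk hx with rfl | rfl | rfl | rfl | rfl | rfl | rfl | rfl
      · rw [v2] at hx; right; left; exact_mod_cast hx.symm
      · rw [v8] at hx; exact absurd (by exact_mod_cast hx.symm) hk
      · rw [v4] at hx; right; right; right; left; exact_mod_cast hx.symm
      · rw [v6] at hx; right; right; right; right; right; exact_mod_cast hx.symm
      · rw [v5] at hx; right; right; right; right; left; exact_mod_cast hx.symm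
      · rw [v7] at hx; exact absurd (by exact_mod_cast hx.symm) hk
      · rw [v1] at hx; left; exact_mod_cast hx.symm
      · rw [v3] at hx; right; right; left; exact_mod_cast hx.symm
    · rintro (rfl | rfl | rfl | rfl | rfl | rfl)
      exacts [⟨_, v1.trans (by norm_num)⟩, ⟨_, v2.trans (by norm_num)⟩,
        ⟨_, v3.trans (by norm_num)⟩, ⟨_, v4.trans (by norm_num)⟩,
        ⟨_, v5.trans (by norm_num)⟩, ⟨_, v6.trans (by norm_num)⟩]
  refine ⟨main, v1, v2, v3, v4, v5, v6, v7, v8, fun x hx => ?_⟩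
  have := (main 4374 (by norm_num)).1 ⟨x, by rw [hx]; norm_num⟩
  norm_num at this
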